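/- arXiv:1812.04382 — 2 statements merged into one kernel-verified Lean document; each statement's English description precedes it below -/
import Mathlib

section
/- Consider the following 31 lines in ℙ²(ℚ), defined by linear forms in ℚ[x,y,z]: x+y+iz = 0 for i ∈ {0,2,3,4,5,6,8}; 2x−y+jz = 0 for j ∈ {4,6,7,8,9,10,12}; 3x+kz = 0 for k ∈ {8,10,11,12,13,14,16}; x−2y+lz = 0 for l ∈ {2,4,6}; 4x+y+mz = 0 for m ∈ {14,16,18}; 5x−y+nz = 0 for n ∈ {18,20,22}; and z = 0. Then the set of points of ℙ²(ℚ) lying on at least two of these lines has exactly 127 elements, and the number tᵢ of points lying on exactly i of the 31 lines is: t₂ = 54, t₃ = 42, t₄ = 21, t₅ = 6, t₆ = 1, t₈ = 3, and tᵢ = 0 for all other i ≥ 2. In particular the simplicial arrangement A(31,3) is realizable over the rational numbers. -/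
open MvPolynomial

noncomputable section

/-- The polynomial ring `ℚ[x,y,z]`, with `x = X 0`, `y = X 1`, `z = X 2`. -/
abbrev PolyQ := MvPolynomial (Fin 3) ℚ

/-- The 31 linear forms over `ℚ` realizing the simplicial arrangement `A(31,3)`:
`x+y+iz` for `i ∈ {0,2,3,4,5,6,8}`, `2x−y+jz` for `j ∈ {4,6,7,8,9,10,12}`,
`3x+kz` for `k ∈ {8,10,11,12,13,14,16}`, `x−2y+lz` for `l ∈ {2,4,6}`,
`4x+y+mz` for `m ∈ {14,16,18}`, `5x−y+nz` for `n ∈ {18,20,22}`, and `z`. -/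
def linesQ : Fin 31 → PolyQ :=
  ![X 0 + X 1,
    X 0 + X 1 + C 2 * X 2,
    X 0 + X 1 + C 3 * X 2,
    X 0 + X 1 + C 4 * X 2,
    X 0 + X 1 + C 5 * X 2,
    X 0 + X 1 + C 6 * X 2,
    X 0 + X 1 + C 8 * X 2,
    C 2 * X 0 - X 1 + C 4 * X 2,
    C 2 * X 0 - X 1 + C 6 * X 2,
    C 2 * X 0 - X 1 + C 7 * X 2,
    C 2 * X 0 - X 1 + C 8 * X 2,
    C 2 * X 0 - X 1 + C 9 * X 2,
    C 2 * X 0 - X 1 + C 10 * X 2,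
    C 2 * X 0 - X 1 + C 12 * X 2,
    C 3 * X 0 + C 8 * X 2,
    C 3 * X 0 + C 10 * X 2,
    C 3 * X 0 + C 11 * X 2,
    C 3 * X 0 + C 12 * X 2,
    C 3 * X 0 + C 13 * X 2,
    C 3 * X 0 + C 14 * X 2,
    C 3 * X 0 + C 16 * X 2,
    X 0 - C 2 * X 1 + C 2 * X 2,
    X 0 - C 2 * X 1 + C 4 * X 2,
    X 0 - C 2 * X 1 + C 6 * X 2,
    C 4 * X 0 + X 1 + C 14 * X 2,
    C 4 * X 0 + X 1 + C 16 * X 2,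
    C 4 * X 0 + X 1 + C 18 * X 2,
    C 5 * X 0 - X 1 + C 18 * X 2,
    C 5 * X 0 - X 1 + C 20 * X 2,
    C 5 * X 0 - X 1 + C 22 * X 2,
    X 2]

/-- The projective plane `ℙ²(ℚ)`. -/
abbrev P2Q := Projectivization ℚ (Fin 3 → ℚ)

open Classical in
/-- The number of the 31 lines passing through a point `P ∈ ℙ²(ℚ)`. -/
def multQ (P : P2Q) : ℕ :=
  (Finset.univ.filter fun i => MvPolynomial.eval (Projectivization.rep P) (linesQ i) = 0).card

/-- The set of intersection points: points lying on at least two of the 31 lines. -/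
def SQ : Set P2Q := {P | 2 ≤ multQ P}

end



/-- Integer coefficients of the 31 lines. -/
def coefL : List (ℤ × ℤ × ℤ) :=
  [(1, 1, 0), (1, 1, 2), (1, 1, 3), (1, 1, 4), (1, 1, 5), (1, 1, 6), (1, 1, 8), (2, -1, 4), (2,
   -1, 6), (2, -1, 7), (2, -1, 8), (2, -1, 9), (2, -1, 10), (2, -1, 12), (3, 0, 8), (3, 0, 10),
   (3, 0, 11), (3, 0, 12), (3, 0, 13), (3, 0, 14), (3, 0, 16), (1, -2, 2), (1, -2, 4), (1, -2,
   6), (4, 1, 14), (4, 1, 16), (4, 1, 18), (5, -1, 18), (5, -1, 20), (5, -1, 22), (0, 0, 1)]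

/-- Integer representatives of the intersection points. -/
def ptsL : List (ℤ × ℤ × ℤ) :=
  [(-40, -2, 9), (-38, -10, 9), (-38, 8, 9), (-34, -8, 9), (-34, 10, 9), (-32, 2, 9), (-26, -7,
   6), (-26, -1, 6), (-26, 5, 6), (-25, -8, 6), (-25, -5, 6), (-25, 4, 6), (-25, 7, 6), (-23,
   -7, 6), (-23, -4, 6), (-23, 5, 6), (-23, 8, 6), (-22, -8, 3), (-22, -5, 6), (-22, -2, 3),
   (-22, 1, 6), (-22, 7, 6), (-20, -4, 3), (-17, -7, 3), (-17, 2, 3), (-16, -26, 3), (-16, -20,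
   3), (-16, -14, 3), (-16, -11, 3), (-16, -8, 3), (-16, -5, 3), (-16, -2, 3), (-16, 1, 3),
   (-16, 4, 3), (-16, 7, 3), (-16, 10, 3), (-16, 16, 3), (-16, 22, 3), (-14, -16, 3), (-14, -10,
   3), (-14, -7, 3), (-14, -4, 3), (-14, -1, 3), (-14, 2, 3), (-14, 5, 3), (-14, 8, 3), (-14,
   14, 3), (-13, -14, 3), (-13, -11, 3), (-13, -8, 3), (-13, -5, 3), (-13, -2, 3), (-13, 1, 3),
   (-13, 4, 3), (-13, 7, 3), (-13, 10, 3), (-13, 13, 3), (-11, -13, 3), (-11, -10, 3), (-11, -7,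
   3), (-11, -4, 3), (-11, -1, 3), (-11, 2, 3), (-11, 5, 3), (-11, 8, 3), (-11, 11, 3), (-11,
   14, 3), (-10, -14, 3), (-10, -8, 3), (-10, -5, 3), (-10, -2, 3), (-10, 1, 3), (-10, 4, 3),
   (-10, 7, 3), (-10, 10, 3), (-10, 16, 3), (-9, -1, 2), (-9, 0, 2), (-8, -22, 3), (-8, -16, 3),
   (-8, -10, 3), (-8, -7, 3), (-8, -4, 3), (-8, -1, 3), (-8, 2, 3), (-8, 5, 3), (-8, 8, 3), (-8,
   11, 3), (-8, 14, 3), (-8, 20, 3), (-8, 26, 3), (-7, -2, 3), (-7, 0, 2), (-7, 1, 2), (-7, 7,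
   3), (-6, -8, 1), (-6, -2, 1), (-6, 0, 1), (-6, 6, 1), (-5, -3, 1), (-5, -1, 1), (-5, 0, 1),
   (-5, 2, 1), (-4, -4, 1), (-4, -2, 1), (-4, -1, 1), (-4, 0, 1), (-4, 1, 1), (-4, 2, 1), (-4,
   4, 1), (-4, 4, 3), (-3, -2, 1), (-3, 0, 1), (-3, 1, 1), (-3, 3, 1), (-2, -6, 1), (-2, 0, 1),
   (-2, 2, 1), (-2, 2, 3), (-2, 8, 1), (-2, 8, 3), (-1, 1, 0), (-1, 4, 0), (0, 1, 0), (1, 2, 0),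
   (1, 5, 0), (2, 1, 0)]

def coefF (i : Fin 31) : ℤ × ℤ × ℤ := coefL.get i
def ptF (i : Fin 127) : ℤ × ℤ × ℤ := ptsL.get i

def dotZ (a b : ℤ × ℤ × ℤ) : ℤ := a.1 * b.1 + a.2.1 * b.2.1 + a.2.2 * b.2.2
def crossZ (a b : ℤ × ℤ × ℤ) : ℤ × ℤ × ℤ :=
  (a.2.1 * b.2.2 - a.2.2 * b.2.1, a.2.2 * b.1 - a.1 * b.2.2, a.1 * b.2.1 - a.2.1 * b.1)

def multF (p : Fin 127) : ℕ := (Finset.univ.filter fun i => dotZ (coefF i) (ptF p) = 0).card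

/-- Boolean proportionality test. -/
def propB : ℤ × ℤ × ℤ → ℤ × ℤ × ℤ → Bool
  | (a, b, c), (x, y, z) => (a * y == b * x) && ((b * z == c * y) && (c * x == a * z))

theorem propB_iff (a b : ℤ × ℤ × ℤ) : propB a b = true ↔ crossZ a b = (0, 0, 0) := by
  obtain ⟨a1, a2, a3⟩ := a
  obtain ⟨x, y, z⟩ := b
  simp only [propB, crossZ, Bool.and_eq_true, beq_iff_eq, Prod.mk.injEq, sub_eq_zero]
  tauto

/-- Boolean check of a relation on all ordered pairs of a list. -/
def pairB (r : ℤ × ℤ × ℤ → ℤ × ℤ × ℤ → Bool) : List (ℤ × ℤ × ℤ) → Bool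
  | [] => true
  | a :: l => l.all (r a) && pairB r l

theorem pairB_pairwise (r : ℤ × ℤ × ℤ → ℤ × ℤ × ℤ → Bool) (l : List (ℤ × ℤ × ℤ))
    (h : pairB r l = true) : l.Pairwise (fun a b => r a b = true) := by
  induction l with
  | nil => exact List.Pairwise.nil
  | cons a l ih =>
    simp only [pairB, Bool.and_eq_true, List.all_eq_true] at h
    exact List.Pairwise.cons h.1 (ih h.2)

theorem cross_swap (a b : ℤ × ℤ × ℤ) (h : crossZ a b = (0, 0, 0)) : crossZ b a = (0, 0, 0) := by
  simp only [crossZ, Prod.mk.injEq] at h ⊢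
  refine ⟨?_, ?_, ?_⟩ <;> linarith [h.1, h.2.1, h.2.2]

theorem pts_pair : pairB (fun a b => !propB a b) ptsL = true := by
  decide +kernel

theorem pts_inj (p q : Fin 127) (h : crossZ (ptF p) (ptF q) = (0, 0, 0)) : p = q := by
  have H := List.pairwise_iff_get.1 (pairB_pairwise _ _ pts_pair)
  rcases lt_trichotomy p q with hl | hl | hl
  · have h1 := H p q hl
    have h2 := (propB_iff _ _).2 h
    simp only [ptF] at h2
    rw [h2] at h1
    simp at h1
  · exact hl
  · have h1 := H q p hl
    have h2 := (propB_iff _ _).2 (cross_swap _ _ h)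
    simp only [ptF] at h2
    rw [h2] at h1
    simp at h1

theorem pts_ne : ∀ p : Fin 127, ptF p ≠ (0, 0, 0) := by
  decide +kernel

theorem cross_ne : ∀ i j : Fin 31, i ≠ j → crossZ (coefF i) (coefF j) ≠ (0, 0, 0) := by
  decide +kernel

theorem cross_pair : pairB (fun a b => ptsL.any (propB (crossZ a b))) coefL = true := by
  decide +kernel

theorem cross_pt (i j : Fin 31) (hij : i < j) :
    ∃ p : Fin 127, crossZ (crossZ (coefF i) (coefF j)) (ptF p) = (0, 0, 0) := by
  have H := List.pairwise_iff_get.1 (pairB_pairwise _ _ cross_pair) i j hij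
  simp only [List.any_eq_true] at H
  obtain ⟨x, hx, hp⟩ := H
  obtain ⟨p, rfl⟩ := List.mem_iff_get.1 hx
  exact ⟨p, (propB_iff _ _).1 hp⟩

theorem multF_vals : ∀ p : Fin 127, multF p ∈ [2, 3, 4, 5, 6, 8] := by
  decide +kernel

theorem multF_card : (Finset.univ.filter fun p => multF p = 2).card = 54 ∧
    (Finset.univ.filter fun p => multF p = 3).card = 42 ∧
    (Finset.univ.filter fun p => multF p = 4).card = 21 ∧
    (Finset.univ.filter fun p => multF p = 5).card = 6 ∧
    (Finset.univ.filter fun p => multF p = 6).card = 1 ∧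
    (Finset.univ.filter fun p => multF p = 8).card = 3 := by
  decide +kernel

theorem eval_lines (v : Fin 3 → ℚ) (i : Fin 31) : MvPolynomial.eval v (linesQ i) =
    (coefF i).1 * v 0 + (coefF i).2.1 * v 1 + (coefF i).2.2 * v 2 := by
  fin_cases i <;> simp [linesQ, coefF, coefL] <;> try ring

/-- Rational vector of an integer triple. -/
def vec (a : ℤ × ℤ × ℤ) : Fin 3 → ℚ := ![(a.1 : ℚ), (a.2.1 : ℚ), (a.2.2 : ℚ)]

theorem vec_ne {a : ℤ × ℤ × ℤ} (h : a ≠ (0, 0, 0)) : vec a ≠ 0 := by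
  intro h0
  apply h
  have h1 := congrFun h0 0
  have h2 := congrFun h0 1
  have h3 := congrFun h0 2
  simp [vec] at h1 h2 h3
  ext <;> simp [h1, h2, h3]

noncomputable def ptP (p : Fin 127) : P2Q := Projectivization.mk ℚ (vec (ptF p)) (vec_ne (pts_ne p))

theorem ptP_inj : Function.Injective ptP := by
  intro p q h
  apply pts_inj
  obtain ⟨a, ha⟩ := (Projectivization.mk_eq_mk_iff' ℚ _ _ _ _).1 h
  have h1 := congrFun ha 0
  have h2 := congrFun ha 1
  have h3 := congrFun ha 2
  simp [vec] at h1 h2 h3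
  have e1 : ((crossZ (ptF p) (ptF q)).1 : ℚ) = 0 := by
    simp only [crossZ]; push_cast; rw [← h2, ← h3]; ring
  have e2 : ((crossZ (ptF p) (ptF q)).2.1 : ℚ) = 0 := by
    simp only [crossZ]; push_cast; rw [← h1, ← h3]; ring
  have e3 : ((crossZ (ptF p) (ptF q)).2.2 : ℚ) = 0 := by
    simp only [crossZ]; push_cast; rw [← h1, ← h2]; ring
  ext
  · exact_mod_cast e1
  · exact_mod_cast e2
  · exact_mod_cast e3

theorem mult_ptP (p : Fin 127) : multQ (ptP p) = multF p := by
  classical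
  unfold multQ multF
  congr 1
  ext i
  simp only [Finset.mem_filter, Finset.mem_univ, true_and]
  obtain ⟨a, ha⟩ := Projectivization.exists_smul_eq_mk_rep ℚ (vec (ptF p)) (vec_ne (pts_ne p))
  have : MvPolynomial.eval (Projectivization.rep (ptP p)) (linesQ i)
      = (a : ℚ) * ((dotZ (coefF i) (ptF p) : ℤ) : ℚ) := by
    rw [eval_lines, ptP, ← ha]
    simp [vec, dotZ, Units.smul_def]
    ring
  rw [this]
  simp

theorem prop_of_cross {a b c x y z : ℚ} {u v w : ℚ} (h : ¬ (a = 0 ∧ b = 0 ∧ c = 0))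
    (hx : x ≠ 0 ∨ y ≠ 0 ∨ z ≠ 0)
    (h1 : b * z - c * y = 0) (h2 : c * x - a * z = 0) (h3 : a * y - b * x = 0)
    (g1 : b * w - c * v = 0) (g2 : c * u - a * w = 0) (g3 : a * v - b * u = 0) :
    ∃ t : ℚ, u = t * x ∧ v = t * y ∧ w = t * z := by
  have k : y * w - z * v = 0 ∧ z * u - x * w = 0 ∧ x * v - y * u = 0 := by
    by_cases ha : a = 0
    · by_cases hb : b = 0
      · have hc : c ≠ 0 := fun hc => h ⟨ha, hb, hc⟩
        refine ⟨?_, ?_, ?_⟩ <;> apply mul_left_cancel₀ hc <;> grind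
      · refine ⟨?_, ?_, ?_⟩ <;> apply mul_left_cancel₀ hb <;> grind
    · refine ⟨?_, ?_, ?_⟩ <;> apply mul_left_cancel₀ ha <;> grind
  obtain ⟨k1, k2, k3⟩ := k
  rcases hx with hx | hx | hx
  · refine ⟨u / x, ?_, ?_, ?_⟩ <;> field_simp <;> linarith
  · refine ⟨v / y, ?_, ?_, ?_⟩ <;> field_simp <;> linarith
  · refine ⟨w / z, ?_, ?_, ?_⟩ <;> field_simp <;> linarith

theorem exists_pt (P : P2Q) (h : 2 ≤ multQ P) : ∃ p, ptP p = P := by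
  classical
  unfold multQ at h
  obtain ⟨i, hi, j, hj, hij⟩ := Finset.one_lt_card.1 h
  simp only [Finset.mem_filter, Finset.mem_univ, true_and] at hi hj
  rw [eval_lines] at hi hj
  wlog hlt : i < j generalizing i j
  · exact this j i (Ne.symm hij) hj hi (lt_of_le_of_ne (not_lt.1 hlt) (Ne.symm hij))
  obtain ⟨p, hp⟩ := cross_pt i j hlt
  refine ⟨p, ?_⟩
  have hc := cross_ne i j hij
  have hv := P.rep_nonzero
  rw [← P.mk_rep, ptP, Projectivization.mk_eq_mk_iff']
  generalize P.rep = v at *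
  generalize coefF i = A at *
  generalize coefF j = B at *
  generalize ptF p = Q at *
  obtain ⟨q1, q2, q3⟩ := Q
  simp only [crossZ, Prod.mk.injEq, ne_eq] at hp hc
  obtain ⟨p1, p2, p3⟩ := hp
  have hv' : v 0 ≠ 0 ∨ v 1 ≠ 0 ∨ v 2 ≠ 0 := by
    by_contra hcon
    push Not at hcon
    apply hv
    ext k
    fin_cases k
    · exact hcon.1
    · exact hcon.2.1
    · exact hcon.2.2
  obtain ⟨t, t1, t2, t3⟩ := prop_of_cross (u := q1) (v := q2) (w := q3)
    (a := A.2.1 * B.2.2 - A.2.2 * B.2.1) (b := A.2.2 * B.1 - A.1 * B.2.2)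
    (c := A.1 * B.2.1 - A.2.1 * B.1)
    (by exact_mod_cast hc) hv' (by linear_combination (-(A.1 : ℚ)) * hj + (B.1 : ℚ) * hi)
    (by linear_combination (-(A.2.1 : ℚ)) * hj + (B.2.1 : ℚ) * hi)
    (by linear_combination (-(A.2.2 : ℚ)) * hj + (B.2.2 : ℚ) * hi)
    (by exact_mod_cast p1) (by exact_mod_cast p2) (by exact_mod_cast p3)
  refine ⟨t, ?_⟩
  ext k
  fin_cases k
  · simp [vec, t1]
  · simp [vec, t2]
  · simp [vec, t3]

theorem ncard_mult (m : ℕ) (hm : 2 ≤ m) : {P : P2Q | multQ P = m}.ncard =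
    (Finset.univ.filter fun p => multF p = m).card := by
  have : {P : P2Q | multQ P = m} =
      ptP '' (((Finset.univ.filter fun p => multF p = m) : Finset (Fin 127)) : Set (Fin 127)) := by
    ext P
    simp only [Set.mem_ofPred_eq, Set.mem_image, Finset.coe_filter, Finset.mem_univ, true_and]
    constructor
    · intro h
      obtain ⟨p, rfl⟩ := exists_pt P (by omega)
      exact ⟨p, by rw [← mult_ptP, h], rfl⟩
    · rintro ⟨p, hp, rfl⟩
      rw [mult_ptP, hp]
  rw [this, Set.ncard_image_of_injective _ ptP_inj, Set.ncard_coe_finset]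

theorem mult_two_le (p : Fin 127) : 2 ≤ multF p := by
  have := multF_vals p
  simp at this
  omega

theorem ncard_SQ : SQ.ncard = 127 := by
  have : SQ = ptP '' Set.univ := by
    ext P
    simp only [SQ, Set.mem_ofPred_eq, Set.image_univ, Set.mem_range]
    constructor
    · exact exists_pt P
    · rintro ⟨p, rfl⟩
      rw [mult_ptP]
      exact mult_two_le p
  rw [this, Set.ncard_image_of_injective _ ptP_inj, Set.ncard_univ, Nat.card_eq_fintype_card,
    Fintype.card_fin]

/-- The 31 rational lines above intersect in exactly 127 points of `ℙ²(ℚ)`, with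
multiplicity vector `t₂ = 54`, `t₃ = 42`, `t₄ = 21`, `t₅ = 6`, `t₆ = 1`, `t₈ = 3`, and
`tᵢ = 0` for all other `i ≥ 2`; in particular the simplicial arrangement `A(31,3)` is
realizable over the rational numbers. -/
theorem stmt8 :
    SQ.ncard = 127 ∧
    {P : P2Q | multQ P = 2}.ncard = 54 ∧
    {P : P2Q | multQ P = 3}.ncard = 42 ∧
    {P : P2Q | multQ P = 4}.ncard = 21 ∧
    {P : P2Q | multQ P = 5}.ncard = 6 ∧
    {P : P2Q | multQ P = 6}.ncard = 1 ∧
    {P : P2Q | multQ P = 8}.ncard = 3 ∧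
    ∀ i : ℕ, 2 ≤ i → i ∉ ({2, 3, 4, 5, 6, 8} : Set ℕ) →
      {P : P2Q | multQ P = i} = ∅ := by
  obtain ⟨h2, h3, h4, h5, h6, h8⟩ := multF_card
  refine ⟨ncard_SQ, ?_, ?_, ?_, ?_, ?_, ?_, ?_⟩
  · rw [ncard_mult 2 (by norm_num), h2]
  · rw [ncard_mult 3 (by norm_num), h3]
  · rw [ncard_mult 4 (by norm_num), h4]
  · rw [ncard_mult 5 (by norm_num), h5]
  · rw [ncard_mult 6 (by norm_num), h6]
  · rw [ncard_mult 8 (by norm_num), h8]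
  · intro i hi hn
    rw [Set.eq_empty_iff_forall_notMem]
    intro P hP
    simp only [Set.mem_ofPred_eq] at hP
    obtain ⟨p, rfl⟩ := exists_pt P (by omega)
    rw [mult_ptP] at hP
    have := multF_vals p
    rw [hP] at this
    apply hn
    simpa using this
end

section
/- Consider the 31 lines in ℙ²(ℚ) defined by the linear forms in ℚ[x,y,z]: x+y+iz for i ∈ {0,2,3,4,5,6,8}; 2x−y+jz for j ∈ {4,6,7,8,9,10,12}; 3x+kz for k ∈ {8,10,11,12,13,14,16}; x−2y+lz for l ∈ {2,4,6}; 4x+y+mz for m ∈ {14,16,18}; 5x−y+nz for n ∈ {18,20,22}; and z. Let S be the set of the 127 points of ℙ²(ℚ) lying on at least two of these lines and let I = ⋂_{P∈S} I(P) ⊆ ℚ[x,y,z]. Then the third symbolic power I^(3) = ⋂_{P∈S} I(P)³ is not contained in I². -/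
open MvPolynomial

noncomputable section

/-- The homogeneous vanishing ideal `I(P)` of the projective point spanned by `v`:
polynomials vanishing on the whole line `ℚ·v`. -/
def pointIdealQ (v : Fin 3 → ℚ) : Ideal PolyQ where
  carrier := {f | ∀ c : ℚ, MvPolynomial.eval (c • v) f = 0}
  zero_mem' := by intro c; simp
  add_mem' := by intro a b ha hb c; simp [ha c, hb c]
  smul_mem' := by intro a f hf c; simp [smul_eq_mul, hf c]

end


abbrev Z3 := ℤ × ℤ × ℤ
abbrev Q4 := ℕ × ℕ × ℕ × ℕ


def ptsZ : List Z3 := [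
  (0, 0, 1), (0, 1, 0), (0, 1, 1), (0, 2, 1), (0, 4, 1), (1, 0, 0), (1, 0, 1), (1, 1, 0), (1, 1, 1),
  (1, 1, 2), (1, 2, 1), (1, 2, 2), (1, 3, 1), (1, 4, 1), (2, 0, 1), (2, 1, 1), (2, 1, 2), (2, 2, 1),
  (2, 2, 3), (2, 4, 1), (3, 1, 1), (4, 0, 1), (4, 1, 1), (4, 2, 1), (4, 4, 1), (4, 6, 1), (6, 4, 1),
  (0, -4, 1), (0, -2, 1), (0, -1, 1), (1, -5, 1), (1, -4, 1), (1, -3, 1), (1, -3, 2), (1, -2, 1),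
  (1, -2, 2), (1, -1, 1), (2, -6, 1), (2, -4, 1), (2, -4, 3), (2, -3, 1), (2, -3, 2), (2, -2, 1),
  (2, -1, 1), (2, -1, 2), (3, -4, 1), (3, -2, 1), (3, -2, 2), (3, -1, 1), (3, -1, 2), (4, -10, 1),
  (4, -8, 1), (4, -6, 1), (4, -5, 1), (4, -4, 1), (4, -3, 1), (4, -2, 1), (4, -2, 3), (4, -1, 1),
  (5, -4, 1), (5, -1, 1), (6, -10, 1), (6, -4, 1), (6, -2, 1), (8, -4, 1), (10, -6, 1), (10, -4, 1),
  (-10, 4, 1), (-10, 6, 1), (-8, 4, 1), (-6, 2, 1), (-6, 4, 1), (-6, 10, 1), (-5, 1, 1), (-5, 4, 1),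
  (-4, 0, 1), (-4, 1, 1), (-4, 2, 1), (-4, 2, 3), (-4, 3, 1), (-4, 4, 1), (-4, 5, 1), (-4, 6, 1),
  (-4, 8, 1), (-4, 10, 1), (-3, 1, 1), (-3, 1, 2), (-3, 2, 1), (-3, 2, 2), (-3, 4, 1), (-2, 0, 1),
  (-2, 1, 0), (-2, 1, 1), (-2, 1, 2), (-2, 2, 1), (-2, 3, 1), (-2, 3, 2), (-2, 4, 1), (-2, 4, 3),
  (-2, 6, 1), (-1, 0, 1), (-1, 1, 0), (-1, 1, 1), (-1, 2, 0), (-1, 2, 1), (-1, 2, 2), (-1, 3, 1),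
  (-1, 3, 2), (-1, 4, 1), (-1, 5, 1), (-6, -4, 1), (-4, -6, 1), (-4, -4, 1), (-4, -2, 1), (-4, -1, 1),
  (-3, -1, 1), (-2, -4, 1), (-2, -2, 1), (-2, -2, 3), (-2, -1, 1), (-2, -1, 2), (-1, -4, 1),
  (-1, -3, 1), (-1, -2, 1), (-1, -2, 2), (-1, -1, 1), (-1, -1, 2)]

def pc0 : List (ℕ × ℕ × ℕ) := [
  (0, 0, 1), (0, 1, 0), (0, 1, 1), (0, 2, 1), (0, 4, 1), (1, 0, 0), (1, 0, 1), (1, 1, 0), (1, 1, 1),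
  (1, 1, 2), (1, 2, 1), (1, 2, 2), (1, 3, 1), (1, 4, 1), (2, 0, 1), (2, 1, 1), (2, 1, 2), (2, 2, 1),
  (2, 2, 3), (2, 4, 1), (3, 1, 1), (4, 0, 1), (4, 1, 1), (4, 2, 1), (4, 4, 1), (4, 6, 1), (6, 4, 1)]

def pc1 : List (ℕ × ℕ × ℕ) := [
  (0, 4, 1), (0, 2, 1), (0, 1, 1), (1, 5, 1), (1, 4, 1), (1, 3, 1), (1, 3, 2), (1, 2, 1), (1, 2, 2),
  (1, 1, 1), (2, 6, 1), (2, 4, 1), (2, 4, 3), (2, 3, 1), (2, 3, 2), (2, 2, 1), (2, 1, 1), (2, 1, 2),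
  (3, 4, 1), (3, 2, 1), (3, 2, 2), (3, 1, 1), (3, 1, 2), (4, 10, 1), (4, 8, 1), (4, 6, 1), (4, 5, 1),
  (4, 4, 1), (4, 3, 1), (4, 2, 1), (4, 2, 3), (4, 1, 1), (5, 4, 1), (5, 1, 1), (6, 10, 1), (6, 4, 1),
  (6, 2, 1), (8, 4, 1), (10, 6, 1), (10, 4, 1)]

def pc2 : List (ℕ × ℕ × ℕ) := [
  (10, 4, 1), (10, 6, 1), (8, 4, 1), (6, 2, 1), (6, 4, 1), (6, 10, 1), (5, 1, 1), (5, 4, 1),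
  (4, 0, 1), (4, 1, 1), (4, 2, 1), (4, 2, 3), (4, 3, 1), (4, 4, 1), (4, 5, 1), (4, 6, 1), (4, 8, 1),
  (4, 10, 1), (3, 1, 1), (3, 1, 2), (3, 2, 1), (3, 2, 2), (3, 4, 1), (2, 0, 1), (2, 1, 0), (2, 1, 1),
  (2, 1, 2), (2, 2, 1), (2, 3, 1), (2, 3, 2), (2, 4, 1), (2, 4, 3), (2, 6, 1), (1, 0, 1), (1, 1, 0),
  (1, 1, 1), (1, 2, 0), (1, 2, 1), (1, 2, 2), (1, 3, 1), (1, 3, 2), (1, 4, 1), (1, 5, 1)]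

def pc3 : List (ℕ × ℕ × ℕ) := [
  (6, 4, 1), (4, 6, 1), (4, 4, 1), (4, 2, 1), (4, 1, 1), (3, 1, 1), (2, 4, 1), (2, 2, 1), (2, 2, 3),
  (2, 1, 1), (2, 1, 2), (1, 4, 1), (1, 3, 1), (1, 2, 1), (1, 2, 2), (1, 1, 1), (1, 1, 2)]

def gp0 : List Q4 := [
  (49152, 1, 0, 13), (27456, 1, 6, 7), (82368, 2, 5, 7), (320320, 3, 2, 9), (64064, 3, 4, 7),
  (320320, 4, 1, 9), (128128, 5, 0, 9), (9009, 5, 6, 3), (12012, 6, 3, 5), (27027, 6, 5, 3),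
  (101244, 7, 2, 5), (21021, 7, 4, 3), (77220, 8, 1, 5), (17160, 9, 0, 5), (143, 10, 3, 1),
  (546, 11, 2, 1), (260, 12, 1, 1), (40, 13, 0, 1)]

def gn0 : List Q4 := [
  (119808, 1, 2, 11), (119808, 2, 1, 11), (119808, 3, 0, 11), (36036, 3, 6, 5), (9152, 4, 3, 7),
  (108108, 4, 5, 5), (288288, 5, 2, 7), (84084, 5, 4, 5), (269984, 6, 1, 7), (73216, 7, 0, 7),
  (429, 7, 6, 1), (3003, 8, 3, 3), (1287, 8, 5, 1), (14014, 9, 2, 3), (1001, 9, 4, 1),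
  (8008, 10, 1, 3), (1456, 11, 0, 3)]

def cc0 : List (List ℤ) := [
  [0, 0, 0, 0, 0, 0, 184064762097031359881592255904509806110310400, 0,
  -39446516429516140927383818774517458573721600, -15288773627157299478989929413186278400,
  -450080292955336997043553177154168881152000, 481252390849520340069714822275471778816,
  84263357130939204358630955654838933706752, -14476658169077130555796379065276109875200,
  -2108575977534289427615594023071340904832000, 1791187452365390565202164796666848962150400,
  249639460971790724847671072153381010432, -35857085257178220639187274038176853851750,
  -357019110624020505468281211802582144, 2537277765088798032585571507583739174876,
  -99755678973105046063986850847989895473152, -30752831005920821145158211828205930120200,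
  6976552915620530976821085753960008908800, 566766857436588264539158209229429281024,
  -99385968452341846053074623691889789000, 1051555516143680559462039993449520000,
  -322911516796650391962298595732477775],
  [0, 0, 0, 14476658169077130555796379065276109875200, -84263357130939204358630955654838933706752,
  450080292955336997043553177154168881152000, -481252390849520340069714822275471778816,
  39446516429516140927383818774517458573721600, 15288773627157299478989929413186278400,
  -184064762097031359881592255904509806110310400, -2537277765088798032585571507583739174876,
  35857085257178220639187274038176853851750, 357019110624020505468281211802582144,
  -1791187452365390565202164796666848962150400, -249639460971790724847671072153381010432,
  2108575977534289427615594023071340904832000, 0, 0, 99755678973105046063986850847989895473152,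
  -2241267745320727562245717973821017843302400, 231612929877729615222043750122090768384,
  2241267745320727562245717973821017843302400, -231612929877729615222043750122090768384,
  -1051555516143680559462039993449520000, 99385968452341846053074623691889789000,
  -566766857436588264539158209229429281024, -6976552915620530976821085753960008908800,
  30752831005920821145158211828205930120200, 184019036104044250422617806502828829179904, 0, 0,
  -184019036104044250422617806502828829179904, -21453211084697661532617464819236118784000,
  21453211084697661532617464819236118784000, 322911516796650391962298595732477775,
  1970510907652209768046413298354309893852, -1970510907652209768046413298354309893852, 0,
  1374467032940330951424338589181997775, -1374467032940330951424338589181997775],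
  [-1374467032940330951424338589181997775, 1374467032940330951424338589181997775, 0,
  -1970510907652209768046413298354309893852, 1970510907652209768046413298354309893852,
  322911516796650391962298595732477775, 21453211084697661532617464819236118784000,
  -21453211084697661532617464819236118784000, -30752831005920821145158211828205930120200,
  -184019036104044250422617806502828829179904, 0, 0, 184019036104044250422617806502828829179904,
  30752831005920821145158211828205930120200, -6976552915620530976821085753960008908800,
  -566766857436588264539158209229429281024, 99385968452341846053074623691889789000,
  -1051555516143680559462039993449520000, 2241267745320727562245717973821017843302400,
  -231612929877729615222043750122090768384, -2241267745320727562245717973821017843302400,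
  231612929877729615222043750122090768384, 99755678973105046063986850847989895473152,
  -2108575977534289427615594023071340904832000, 0, 0, 0, 2108575977534289427615594023071340904832000,
  -1791187452365390565202164796666848962150400, -249639460971790724847671072153381010432,
  35857085257178220639187274038176853851750, 357019110624020505468281211802582144,
  -2537277765088798032585571507583739174876, 184064762097031359881592255904509806110310400, 0,
  -184064762097031359881592255904509806110310400, 0, 39446516429516140927383818774517458573721600,
  15288773627157299478989929413186278400, 450080292955336997043553177154168881152000,
  -481252390849520340069714822275471778816, -84263357130939204358630955654838933706752,
  14476658169077130555796379065276109875200],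
  [-322911516796650391962298595732477775, 1051555516143680559462039993449520000,
  -99385968452341846053074623691889789000, 566766857436588264539158209229429281024,
  6976552915620530976821085753960008908800, -99755678973105046063986850847989895473152,
  2537277765088798032585571507583739174876, -35857085257178220639187274038176853851750,
  -357019110624020505468281211802582144, 1791187452365390565202164796666848962150400,
  249639460971790724847671072153381010432, -14476658169077130555796379065276109875200,
  84263357130939204358630955654838933706752, -450080292955336997043553177154168881152000,
  481252390849520340069714822275471778816, -39446516429516140927383818774517458573721600,
  -15288773627157299478989929413186278400]]

def gp1 : List Q4 := [
  (49152, 0, 1, 13), (128128, 0, 5, 9), (17160, 0, 9, 5), (40, 0, 13, 1), (320320, 1, 4, 9),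
  (77220, 1, 8, 5), (260, 1, 12, 1), (320320, 2, 3, 9), (101244, 2, 7, 5), (546, 2, 11, 1),
  (12012, 3, 6, 5), (143, 3, 10, 1), (64064, 4, 3, 7), (21021, 4, 7, 3), (82368, 5, 2, 7),
  (27027, 5, 6, 3), (27456, 6, 1, 7), (9009, 6, 5, 3)]

def gn1 : List Q4 := [
  (119808, 0, 3, 11), (73216, 0, 7, 7), (1456, 0, 11, 3), (119808, 1, 2, 11), (269984, 1, 6, 7),
  (8008, 1, 10, 3), (119808, 2, 1, 11), (288288, 2, 5, 7), (14014, 2, 9, 3), (9152, 3, 4, 7),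
  (3003, 3, 8, 3), (84084, 4, 5, 5), (1001, 4, 9, 1), (108108, 5, 4, 5), (1287, 5, 8, 1),
  (36036, 6, 3, 5), (429, 6, 7, 1)]

def cc1 : List (List ℤ) := [
  [0, 0, -184064762097031359881592255904509806110310400, 2108575977534289427615594023071340904832000,
  30752831005920821145158211828205930120200, 0, 0, 0, 39446516429516140927383818774517458573721600,
  15288773627157299478989929413186278400, -1791187452365390565202164796666848962150400,
  -249639460971790724847671072153381010432, 99755678973105046063986850847989895473152,
  -6976552915620530976821085753960008908800, 0, 450080292955336997043553177154168881152000,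
  -481252390849520340069714822275471778816, 35857085257178220639187274038176853851750,
  357019110624020505468281211802582144, -566766857436588264539158209229429281024,
  -84263357130939204358630955654838933706752, 0, 14476658169077130555796379065276109875200,
  -2537277765088798032585571507583739174876, 99385968452341846053074623691889789000,
  322911516796650391962298595732477775, -1051555516143680559462039993449520000],
  [30752831005920821145158211828205930120200, 2108575977534289427615594023071340904832000,
  -184064762097031359881592255904509806110310400, -21453211084697661532617464819236118784000,
  184019036104044250422617806502828829179904, -2241267745320727562245717973821017843302400,
  231612929877729615222043750122090768384, 0, 0, 184064762097031359881592255904509806110310400,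
  1970510907652209768046413298354309893852, 0, 0, 2241267745320727562245717973821017843302400,
  -231612929877729615222043750122090768384, -2108575977534289427615594023071340904832000,
  -39446516429516140927383818774517458573721600, -15288773627157299478989929413186278400,
  -184019036104044250422617806502828829179904, 1791187452365390565202164796666848962150400,
  249639460971790724847671072153381010432, -450080292955336997043553177154168881152000,
  481252390849520340069714822275471778816, 1374467032940330951424338589181997775, 0,
  -1970510907652209768046413298354309893852, 21453211084697661532617464819236118784000,
  -30752831005920821145158211828205930120200, -99755678973105046063986850847989895473152,
  -35857085257178220639187274038176853851750, -357019110624020505468281211802582144,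
  84263357130939204358630955654838933706752, 6976552915620530976821085753960008908800,
  -14476658169077130555796379065276109875200, -1374467032940330951424338589181997775,
  566766857436588264539158209229429281024, 2537277765088798032585571507583739174876,
  -99385968452341846053074623691889789000, -322911516796650391962298595732477775,
  1051555516143680559462039993449520000],
  [1051555516143680559462039993449520000, -322911516796650391962298595732477775,
  -99385968452341846053074623691889789000, 2537277765088798032585571507583739174876,
  566766857436588264539158209229429281024, -1374467032940330951424338589181997775,
  -14476658169077130555796379065276109875200, 6976552915620530976821085753960008908800, 0,
  84263357130939204358630955654838933706752, -35857085257178220639187274038176853851750,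
  -357019110624020505468281211802582144, -99755678973105046063986850847989895473152,
  -30752831005920821145158211828205930120200, 21453211084697661532617464819236118784000,
  -1970510907652209768046413298354309893852, 0, 1374467032940330951424338589181997775,
  -450080292955336997043553177154168881152000, 481252390849520340069714822275471778816,
  1791187452365390565202164796666848962150400, 249639460971790724847671072153381010432,
  -184019036104044250422617806502828829179904, 0, 0, -39446516429516140927383818774517458573721600,
  -15288773627157299478989929413186278400, -2108575977534289427615594023071340904832000,
  2241267745320727562245717973821017843302400, -231612929877729615222043750122090768384, 0, 0,
  1970510907652209768046413298354309893852, 0, 0, 184064762097031359881592255904509806110310400, 0, 0,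
  0, -2241267745320727562245717973821017843302400, 231612929877729615222043750122090768384,
  184019036104044250422617806502828829179904, -21453211084697661532617464819236118784000],
  [-1051555516143680559462039993449520000, 322911516796650391962298595732477775,
  99385968452341846053074623691889789000, -2537277765088798032585571507583739174876,
  14476658169077130555796379065276109875200, -84263357130939204358630955654838933706752,
  -566766857436588264539158209229429281024, 35857085257178220639187274038176853851750,
  357019110624020505468281211802582144, 450080292955336997043553177154168881152000,
  -481252390849520340069714822275471778816, -6976552915620530976821085753960008908800,
  99755678973105046063986850847989895473152, -1791187452365390565202164796666848962150400,
  -249639460971790724847671072153381010432, 39446516429516140927383818774517458573721600,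
  15288773627157299478989929413186278400]]

def gp2 : List Q4 := [
  (100672, 1, 7, 6), (1456, 1, 11, 2), (352352, 2, 6, 6), (8008, 2, 10, 2), (352352, 3, 5, 6),
  (14014, 3, 9, 2), (320320, 4, 2, 8), (3003, 4, 8, 2), (128128, 5, 1, 8), (1001, 5, 9, 0),
  (120120, 6, 4, 4), (1287, 6, 8, 0), (137280, 7, 3, 4), (12012, 7, 5, 2), (77220, 8, 2, 4),
  (17160, 9, 1, 4), (143, 10, 4, 0), (546, 11, 3, 0), (260, 12, 2, 0), (40, 13, 1, 0)]

def gn2 : List Q4 := [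
  (128128, 1, 5, 8), (17160, 1, 9, 4), (40, 1, 13, 0), (320320, 2, 4, 8), (77220, 2, 8, 4),
  (260, 2, 12, 0), (137280, 3, 7, 4), (546, 3, 11, 0), (120120, 4, 6, 4), (143, 4, 10, 0),
  (352352, 5, 3, 6), (12012, 5, 7, 2), (352352, 6, 2, 6), (100672, 7, 1, 6), (3003, 8, 4, 2),
  (1287, 8, 6, 0), (14014, 9, 3, 2), (1001, 9, 5, 0), (8008, 10, 2, 2), (1456, 11, 1, 2)]

def cc2 : List (List ℤ) := [
  [0, 0, 0, 0, 0, 0, 0, -281814890142768223443654906549556328045963937152000,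
  -59169774644274211391075728161776187860582400, -11466580220367974609242447059889708800,
  668270149841037428336293831768883399884800, 454554091001561776870162768764121713024,
  114775794314784425258929512087395179235328, -38197559820515993434773322880358322944000, 0,
  668270149841037428336293831768883399884800, 454554091001561776870162768764121713024,
  -107571255771534661917561822114530561555250, -357019110624020505468281211802582144,
  8461983581421276494565451836595361446164, 114775794314784425258929512087395179235328, 0,
  -38197559820515993434773322880358322944000, 8461983581421276494565451836595361446164,
  -596315810714051076318447742151338734000, 3763265272256611341692284183325406675,
  3763265272256611341692284183325406675],
  [0, 0, 0, -38197559820515993434773322880358322944000, 114775794314784425258929512087395179235328,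
  668270149841037428336293831768883399884800, 454554091001561776870162768764121713024,
  -59169774644274211391075728161776187860582400, -11466580220367974609242447059889708800, 0,
  8461983581421276494565451836595361446164, -107571255771534661917561822114530561555250,
  -357019110624020505468281211802582144, 668270149841037428336293831768883399884800,
  454554091001561776870162768764121713024, 0, 59169774644274211391075728161776187860582400,
  11466580220367974609242447059889708800, 114775794314784425258929512087395179235328,
  -668270149841037428336293831768883399884800, -454554091001561776870162768764121713024,
  -668270149841037428336293831768883399884800, -454554091001561776870162768764121713024,
  3763265272256611341692284183325406675, -596315810714051076318447742151338734000,
  8461983581421276494565451836595361446164, -38197559820515993434773322880358322944000, 0,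
  -114775794314784425258929512087395179235328, 107571255771534661917561822114530561555250,
  357019110624020505468281211802582144, -114775794314784425258929512087395179235328,
  38197559820515993434773322880358322944000, 38197559820515993434773322880358322944000,
  3763265272256611341692284183325406675, -8461983581421276494565451836595361446164,
  -8461983581421276494565451836595361446164, 596315810714051076318447742151338734000,
  -3763265272256611341692284183325406675, -3763265272256611341692284183325406675],
  [3763265272256611341692284183325406675, 3763265272256611341692284183325406675,
  -596315810714051076318447742151338734000, 8461983581421276494565451836595361446164,
  8461983581421276494565451836595361446164, -3763265272256611341692284183325406675,
  -38197559820515993434773322880358322944000, -38197559820515993434773322880358322944000, 0,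
  114775794314784425258929512087395179235328, -107571255771534661917561822114530561555250,
  -357019110624020505468281211802582144, 114775794314784425258929512087395179235328, 0,
  38197559820515993434773322880358322944000, -8461983581421276494565451836595361446164,
  596315810714051076318447742151338734000, -3763265272256611341692284183325406675,
  668270149841037428336293831768883399884800, 454554091001561776870162768764121713024,
  668270149841037428336293831768883399884800, 454554091001561776870162768764121713024,
  -114775794314784425258929512087395179235328, 0,
  -281814890142768223443654906549556328045963937152000, -59169774644274211391075728161776187860582400,
  -11466580220367974609242447059889708800, 0, -668270149841037428336293831768883399884800,
  -454554091001561776870162768764121713024, 107571255771534661917561822114530561555250,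
  357019110624020505468281211802582144, -8461983581421276494565451836595361446164, 0, 0, 0,
  281814890142768223443654906549556328045963937152000, 59169774644274211391075728161776187860582400,
  11466580220367974609242447059889708800, -668270149841037428336293831768883399884800,
  -454554091001561776870162768764121713024, -114775794314784425258929512087395179235328,
  38197559820515993434773322880358322944000],
  [-3763265272256611341692284183325406675, -3763265272256611341692284183325406675,
  596315810714051076318447742151338734000, -8461983581421276494565451836595361446164,
  38197559820515993434773322880358322944000, -114775794314784425258929512087395179235328,
  -8461983581421276494565451836595361446164, 107571255771534661917561822114530561555250,
  357019110624020505468281211802582144, -668270149841037428336293831768883399884800,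
  -454554091001561776870162768764121713024, 38197559820515993434773322880358322944000,
  -114775794314784425258929512087395179235328, -668270149841037428336293831768883399884800,
  -454554091001561776870162768764121713024, 59169774644274211391075728161776187860582400,
  11466580220367974609242447059889708800]]

def gp3 : List Q4 := [
  (198176, 0, 5, 10), (22442, 0, 9, 6), (42, 0, 13, 2), (495440, 1, 4, 10), (100989, 1, 8, 6),
  (273, 1, 12, 2), (166656, 2, 1, 12), (198176, 2, 3, 10), (179312, 2, 7, 6), (828, 2, 11, 2),
  (111104, 3, 0, 12), (156310, 3, 6, 6), (1551, 3, 10, 2), (269640, 4, 3, 8), (44324, 4, 5, 6),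
  (1950, 4, 9, 2), (485352, 5, 2, 8), (1647, 5, 8, 2), (377496, 6, 1, 8), (9198, 6, 5, 4),
  (630, 6, 7, 2), (107856, 7, 0, 8), (23496, 7, 4, 4), (29676, 8, 3, 4), (30, 8, 7, 0),
  (22178, 9, 2, 4), (69, 9, 6, 0), (9350, 10, 1, 4), (66, 10, 5, 0), (1700, 11, 0, 4), (38, 11, 4, 0),
  (13, 12, 3, 0), (2, 13, 2, 0)]

def gn3 : List Q4 := [
  (111104, 0, 3, 12), (107856, 0, 7, 8), (1700, 0, 11, 4), (166656, 1, 2, 12), (377496, 1, 6, 8),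
  (9350, 1, 10, 4), (485352, 2, 5, 8), (22178, 2, 9, 4), (2, 2, 13, 0), (198176, 3, 2, 10),
  (269640, 3, 4, 8), (29676, 3, 8, 4), (13, 3, 12, 0), (495440, 4, 1, 10), (23496, 4, 7, 4),
  (38, 4, 11, 0), (198176, 5, 0, 10), (44324, 5, 4, 6), (9198, 5, 6, 4), (66, 5, 10, 0),
  (156310, 6, 3, 6), (69, 6, 9, 0), (179312, 7, 2, 6), (630, 7, 6, 2), (30, 7, 8, 0),
  (100989, 8, 1, 6), (1647, 8, 5, 2), (22442, 9, 0, 6), (1950, 9, 4, 2), (1551, 10, 3, 2),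
  (828, 11, 2, 2), (273, 12, 1, 2), (42, 13, 0, 2)]

def cc3 : List (List ℤ) := [
  [4496183408351784205083264957058697309952000000, -82852276054096325702765634562371773490014453760000,
  6700666868297282362206340374012746897345740800, -7330606616496723537091881186592267810176000,
  -230266345076721911874838180231446673122000, -82852276054096325702765634562371773490014453760000,
  6700666868297282362206340374012746897345740800,
  -1973902903974697244743645191254336017581730408064000,
  564905184992283021114112376079258833639178240, -26853083086582682383412610332420930150400,
  -13076988809365311547054355377798929658675200, -7688859799488047451252363164224662436608,
  1756358416788317928075268014140979166574592, -25730407215828977380599701282075308800000,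
  -7330606616496723537091881186592267810176000, -13076988809365311547054355377798929658675200,
  -7688859799488047451252363164224662436608, -269602414866784213170357976250060549760750,
  7966001334939612846979242548669884288, -26957024931613868126652133535714875159596,
  1756358416788317928075268014140979166574592, -230266345076721911874838180231446673122000,
  -25730407215828977380599701282075308800000, -26957024931613868126652133535714875159596,
  455751689179165017301555805377201865040, 53619416512058614762577155262843405475,
  53619416512058614762577155262843405475],
  [-230266345076721911874838180231446673122000, -7330606616496723537091881186592267810176000,
  6700666868297282362206340374012746897345740800, -25730407215828977380599701282075308800000,
  1756358416788317928075268014140979166574592, -13076988809365311547054355377798929658675200,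
  -7688859799488047451252363164224662436608, 564905184992283021114112376079258833639178240,
  -26853083086582682383412610332420930150400, 6700666868297282362206340374012746897345740800,
  -26957024931613868126652133535714875159596, -269602414866784213170357976250060549760750,
  7966001334939612846979242548669884288, -13076988809365311547054355377798929658675200,
  -7688859799488047451252363164224662436608, -7330606616496723537091881186592267810176000,
  564905184992283021114112376079258833639178240, -26853083086582682383412610332420930150400,
  1756358416788317928075268014140979166574592, -13076988809365311547054355377798929658675200,
  -7688859799488047451252363164224662436608, -13076988809365311547054355377798929658675200,
  -7688859799488047451252363164224662436608, 53619416512058614762577155262843405475,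
  455751689179165017301555805377201865040, -26957024931613868126652133535714875159596,
  -25730407215828977380599701282075308800000, -230266345076721911874838180231446673122000,
  1756358416788317928075268014140979166574592, -269602414866784213170357976250060549760750,
  7966001334939612846979242548669884288, 1756358416788317928075268014140979166574592,
  -25730407215828977380599701282075308800000, -25730407215828977380599701282075308800000,
  53619416512058614762577155262843405475, -26957024931613868126652133535714875159596,
  -26957024931613868126652133535714875159596, 455751689179165017301555805377201865040,
  53619416512058614762577155262843405475, 53619416512058614762577155262843405475],
  [53619416512058614762577155262843405475, 53619416512058614762577155262843405475,
  455751689179165017301555805377201865040, -26957024931613868126652133535714875159596,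
  -26957024931613868126652133535714875159596, 53619416512058614762577155262843405475,
  -25730407215828977380599701282075308800000, -25730407215828977380599701282075308800000,
  -230266345076721911874838180231446673122000, 1756358416788317928075268014140979166574592,
  -269602414866784213170357976250060549760750, 7966001334939612846979242548669884288,
  1756358416788317928075268014140979166574592, -230266345076721911874838180231446673122000,
  -25730407215828977380599701282075308800000, -26957024931613868126652133535714875159596,
  455751689179165017301555805377201865040, 53619416512058614762577155262843405475,
  -13076988809365311547054355377798929658675200, -7688859799488047451252363164224662436608,
  -13076988809365311547054355377798929658675200, -7688859799488047451252363164224662436608,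
  1756358416788317928075268014140979166574592, -7330606616496723537091881186592267810176000,
  -1973902903974697244743645191254336017581730408064000,
  564905184992283021114112376079258833639178240, -26853083086582682383412610332420930150400,
  -7330606616496723537091881186592267810176000, -13076988809365311547054355377798929658675200,
  -7688859799488047451252363164224662436608, -269602414866784213170357976250060549760750,
  7966001334939612846979242548669884288, -26957024931613868126652133535714875159596,
  6700666868297282362206340374012746897345740800, -82852276054096325702765634562371773490014453760000,
  6700666868297282362206340374012746897345740800,
  -1973902903974697244743645191254336017581730408064000,
  564905184992283021114112376079258833639178240, -26853083086582682383412610332420930150400,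
  -13076988809365311547054355377798929658675200, -7688859799488047451252363164224662436608,
  1756358416788317928075268014140979166574592, -25730407215828977380599701282075308800000],
  [53619416512058614762577155262843405475, 53619416512058614762577155262843405475,
  455751689179165017301555805377201865040, -26957024931613868126652133535714875159596,
  -25730407215828977380599701282075308800000, 1756358416788317928075268014140979166574592,
  -26957024931613868126652133535714875159596, -269602414866784213170357976250060549760750,
  7966001334939612846979242548669884288, -13076988809365311547054355377798929658675200,
  -7688859799488047451252363164224662436608, -25730407215828977380599701282075308800000,
  1756358416788317928075268014140979166574592, -13076988809365311547054355377798929658675200,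
  -7688859799488047451252363164224662436608, 564905184992283021114112376079258833639178240,
  -26853083086582682383412610332420930150400]]

def gp4 : List Q4 := [
  (211072, 0, 5, 10), (24168, 0, 9, 6), (40, 0, 13, 2), (527680, 1, 4, 10), (108756, 1, 8, 6),
  (260, 1, 12, 2), (175104, 2, 1, 12), (211072, 2, 3, 10), (200496, 2, 7, 6), (852, 2, 11, 2),
  (116736, 3, 0, 12), (194208, 3, 6, 6), (1826, 3, 10, 2), (292000, 4, 3, 8), (66216, 4, 5, 6),
  (2650, 4, 9, 2), (525600, 5, 2, 8), (2520, 5, 8, 2), (408800, 6, 1, 8), (15498, 6, 5, 4),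
  (1044, 6, 7, 2), (116800, 7, 0, 8), (36228, 7, 4, 4), (38238, 8, 3, 4), (108, 8, 7, 0),
  (24484, 9, 2, 4), (189, 9, 6, 0), (9592, 10, 1, 4), (99, 10, 5, 0), (1744, 11, 0, 4), (18, 11, 4, 0)]

def gn4 : List Q4 := [
  (116736, 0, 3, 12), (116800, 0, 7, 8), (1744, 0, 11, 4), (175104, 1, 2, 12), (408800, 1, 6, 8),
  (9592, 1, 10, 4), (525600, 2, 5, 8), (24484, 2, 9, 4), (211072, 3, 2, 10), (292000, 3, 4, 8),
  (38238, 3, 8, 4), (527680, 4, 1, 10), (36228, 4, 7, 4), (18, 4, 11, 0), (211072, 5, 0, 10),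
  (66216, 5, 4, 6), (15498, 5, 6, 4), (99, 5, 10, 0), (194208, 6, 3, 6), (189, 6, 9, 0),
  (200496, 7, 2, 6), (1044, 7, 6, 2), (108, 7, 8, 0), (108756, 8, 1, 6), (2520, 8, 5, 2),
  (24168, 9, 0, 6), (2650, 9, 4, 2), (1826, 10, 3, 2), (852, 11, 2, 2), (260, 12, 1, 2),
  (40, 13, 0, 2)]

def cc4 : List (List ℤ) := [
  [3157978513993531579592302457097267261696000000,
  -168922261720710821419766639064268876015887974400000,
  4568183162530657412883498858406977569724825600, -12459572581218503733239457004599860770176000,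
  -563950423327997953448111905906329483634800, -168922261720710821419766639064268876015887974400000,
  4568183162530657412883498858406977569724825600,
  -1974047727587283588040472837549830075260070504064000,
  369726401149777392253799271796587409204838400, -18209868412552340988413770477071108249600,
  -9149833728351279893142024234514410228940800, -4878042314199203248199603854265928883968,
  1673816922009020298088549536808485920827392, 60663739847126907565410530818667623372800,
  -12459572581218503733239457004599860770176000, -9149833728351279893142024234514410228940800,
  -4878042314199203248199603854265928883968, -447429192864623760874655828605315340162250,
  4891975425692291418283679441146177408, -41929173596704406858784685997691231546756,
  1673816922009020298088549536808485920827392, -563950423327997953448111905906329483634800,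
  60663739847126907565410530818667623372800, -41929173596704406858784685997691231546756,
  1382552005667646237837130665129171567600, 50241100553722091467969855950761080425,
  50241100553722091467969855950761080425],
  [-563950423327997953448111905906329483634800, -12459572581218503733239457004599860770176000,
  4568183162530657412883498858406977569724825600, 60663739847126907565410530818667623372800,
  1673816922009020298088549536808485920827392, -9149833728351279893142024234514410228940800,
  -4878042314199203248199603854265928883968, 369726401149777392253799271796587409204838400,
  -18209868412552340988413770477071108249600, 4568183162530657412883498858406977569724825600,
  -41929173596704406858784685997691231546756, -447429192864623760874655828605315340162250,
  4891975425692291418283679441146177408, -9149833728351279893142024234514410228940800,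
  -4878042314199203248199603854265928883968, -12459572581218503733239457004599860770176000,
  369726401149777392253799271796587409204838400, -18209868412552340988413770477071108249600,
  1673816922009020298088549536808485920827392, -9149833728351279893142024234514410228940800,
  -4878042314199203248199603854265928883968, -9149833728351279893142024234514410228940800,
  -4878042314199203248199603854265928883968, 50241100553722091467969855950761080425,
  1382552005667646237837130665129171567600, -41929173596704406858784685997691231546756,
  60663739847126907565410530818667623372800, -563950423327997953448111905906329483634800,
  1673816922009020298088549536808485920827392, -447429192864623760874655828605315340162250,
  4891975425692291418283679441146177408, 1673816922009020298088549536808485920827392,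
  60663739847126907565410530818667623372800, 60663739847126907565410530818667623372800,
  50241100553722091467969855950761080425, -41929173596704406858784685997691231546756,
  -41929173596704406858784685997691231546756, 1382552005667646237837130665129171567600,
  50241100553722091467969855950761080425, 50241100553722091467969855950761080425],
  [50241100553722091467969855950761080425, 50241100553722091467969855950761080425,
  1382552005667646237837130665129171567600, -41929173596704406858784685997691231546756,
  -41929173596704406858784685997691231546756, 50241100553722091467969855950761080425,
  60663739847126907565410530818667623372800, 60663739847126907565410530818667623372800,
  -563950423327997953448111905906329483634800, 1673816922009020298088549536808485920827392,
  -447429192864623760874655828605315340162250, 4891975425692291418283679441146177408,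
  1673816922009020298088549536808485920827392, -563950423327997953448111905906329483634800,
  60663739847126907565410530818667623372800, -41929173596704406858784685997691231546756,
  1382552005667646237837130665129171567600, 50241100553722091467969855950761080425,
  -9149833728351279893142024234514410228940800, -4878042314199203248199603854265928883968,
  -9149833728351279893142024234514410228940800, -4878042314199203248199603854265928883968,
  1673816922009020298088549536808485920827392, -12459572581218503733239457004599860770176000,
  -1974047727587283588040472837549830075260070504064000,
  369726401149777392253799271796587409204838400, -18209868412552340988413770477071108249600,
  -12459572581218503733239457004599860770176000, -9149833728351279893142024234514410228940800,
  -4878042314199203248199603854265928883968, -447429192864623760874655828605315340162250,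
  4891975425692291418283679441146177408, -41929173596704406858784685997691231546756,
  4568183162530657412883498858406977569724825600,
  -168922261720710821419766639064268876015887974400000,
  4568183162530657412883498858406977569724825600,
  -1974047727587283588040472837549830075260070504064000,
  369726401149777392253799271796587409204838400, -18209868412552340988413770477071108249600,
  -9149833728351279893142024234514410228940800, -4878042314199203248199603854265928883968,
  1673816922009020298088549536808485920827392, 60663739847126907565410530818667623372800],
  [50241100553722091467969855950761080425, 50241100553722091467969855950761080425,
  1382552005667646237837130665129171567600, -41929173596704406858784685997691231546756,
  60663739847126907565410530818667623372800, 1673816922009020298088549536808485920827392,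
  -41929173596704406858784685997691231546756, -447429192864623760874655828605315340162250,
  4891975425692291418283679441146177408, -9149833728351279893142024234514410228940800,
  -4878042314199203248199603854265928883968, 60663739847126907565410530818667623372800,
  1673816922009020298088549536808485920827392, -9149833728351279893142024234514410228940800,
  -4878042314199203248199603854265928883968, 369726401149777392253799271796587409204838400,
  -18209868412552340988413770477071108249600]]

def gp5 : List Q4 := [
  (20480, 0, 3, 12), (6400, 0, 9, 6), (32, 0, 13, 2), (40960, 1, 2, 12), (32768, 1, 8, 6),
  (208, 1, 12, 2), (40960, 2, 1, 12), (292848, 2, 5, 8), (2378, 2, 9, 4), (8, 2, 13, 0),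
  (20480, 3, 0, 12), (808656, 3, 4, 8), (43821, 3, 8, 4), (52, 3, 12, 0), (808656, 4, 3, 8),
  (78693, 4, 7, 4), (128, 4, 11, 0), (292848, 5, 2, 8), (68292, 5, 6, 4), (124, 5, 10, 0),
  (68292, 6, 5, 4), (4383, 6, 7, 2), (78693, 7, 4, 4), (4383, 7, 6, 2), (32768, 8, 1, 6),
  (43821, 8, 3, 4), (6400, 9, 0, 6), (2378, 9, 2, 4), (124, 10, 5, 0), (128, 11, 4, 0),
  (208, 12, 1, 2), (52, 12, 3, 0), (32, 13, 0, 2), (8, 13, 2, 0)]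

def gn5 : List Q4 := [
  (14592, 0, 5, 10), (11456, 0, 7, 8), (864, 0, 11, 4), (99328, 1, 4, 10), (12928, 1, 6, 8),
  (4880, 1, 10, 4), (350720, 2, 3, 10), (22740, 2, 7, 6), (174, 2, 11, 2), (350720, 3, 2, 10),
  (290640, 3, 6, 6), (3109, 3, 10, 2), (99328, 4, 1, 10), (578508, 4, 5, 6), (6581, 4, 9, 2),
  (14592, 5, 0, 10), (578508, 5, 4, 6), (3399, 5, 8, 2), (12928, 6, 1, 8), (290640, 6, 3, 6),
  (52, 6, 9, 0), (11456, 7, 0, 8), (22740, 7, 2, 6), (260, 7, 8, 0), (3399, 8, 5, 2), (260, 8, 7, 0),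
  (6581, 9, 4, 2), (52, 9, 6, 0), (4880, 10, 1, 4), (3109, 10, 3, 2), (864, 11, 0, 4), (174, 11, 2, 2)]

def cc5 : List (List ℤ) := [
  [0, 62139207040572244277074225921778830117510840320000,
  -510466678428614320816822116898001613574963200, 5986998691449393786113839647954608443728000,
  252449731491056353672150279240221081939000, -62139207040572244277074225921778830117510840320000,
  510466678428614320816822116898001613574963200, 0, 0, 0,
  -5245771676602821781448256194156670753177600, 1126061803635998935507859205244141407936,
  366579314167005406062443394720199133724672, -115762183564894445910192838391926080460800,
  -5986998691449393786113839647954608443728000, 5245771676602821781448256194156670753177600,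
  -1126061803635998935507859205244141407936, 0, 0, 20268062207531486650967258205758368510596,
  -366579314167005406062443394720199133724672, -252449731491056353672150279240221081939000,
  115762183564894445910192838391926080460800, -20268062207531486650967258205758368510596, 0,
  -1445086010555191575088201147032631575, 1445086010555191575088201147032631575],
  [252449731491056353672150279240221081939000, 5986998691449393786113839647954608443728000,
  -510466678428614320816822116898001613574963200, -14654880737804732310326593714189514342400,
  -213519748034116031486722181320494002890752, -3367755236771805066997405050479102548377600,
  -899839966119198297781488117623743099392, 87398881075798061929748708681662737475829760,
  1102235417387514211063496265447788275200, 0, 4169358802974891782943949258689176750112,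
  285862574787754112914108606422421956482250, 1845062830036408764199392793162577552,
  1878016439831016714450851143677568204800000, -2025901769755197233289347322867884507328, 0,
  -87398881075798061929748708681662737475829760, -1102235417387514211063496265447788275200,
  -580099062201121437549165576040693136615424, -1878016439831016714450851143677568204800000,
  2025901769755197233289347322867884507328, 3367755236771805066997405050479102548377600,
  899839966119198297781488117623743099392, -17102372664964047503675062258878337575,
  697559355381415291051397543962832480760, -16098703404556594868023308947069191760484,
  101107302827089713599866244677736566118400, 0, 580099062201121437549165576040693136615424,
  -285862574787754112914108606422421956482250, -1845062830036408764199392793162577552,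
  213519748034116031486722181320494002890752, -101107302827089713599866244677736566118400,
  14654880737804732310326593714189514342400, -15657286654408855928586861111845706000,
  16098703404556594868023308947069191760484, -4169358802974891782943949258689176750112,
  -697559355381415291051397543962832480760, 15657286654408855928586861111845706000,
  17102372664964047503675062258878337575],
  [17102372664964047503675062258878337575, 15657286654408855928586861111845706000,
  -697559355381415291051397543962832480760, -4169358802974891782943949258689176750112,
  16098703404556594868023308947069191760484, -15657286654408855928586861111845706000,
  14654880737804732310326593714189514342400, -101107302827089713599866244677736566118400,
  -252449731491056353672150279240221081939000, 213519748034116031486722181320494002890752,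
  -285862574787754112914108606422421956482250, -1845062830036408764199392793162577552,
  580099062201121437549165576040693136615424, 0, 101107302827089713599866244677736566118400,
  -16098703404556594868023308947069191760484, 697559355381415291051397543962832480760,
  -17102372664964047503675062258878337575, 3367755236771805066997405050479102548377600,
  899839966119198297781488117623743099392, -1878016439831016714450851143677568204800000,
  2025901769755197233289347322867884507328, -580099062201121437549165576040693136615424,
  -5986998691449393786113839647954608443728000, -493475725993674311185911297813584004395432602016000,
  -87398881075798061929748708681662737475829760, -1102235417387514211063496265447788275200, 0,
  1878016439831016714450851143677568204800000, -2025901769755197233289347322867884507328,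
  285862574787754112914108606422421956482250, 1845062830036408764199392793162577552,
  4169358802974891782943949258689176750112, 510466678428614320816822116898001613574963200, 0, 0,
  493475725993674311185911297813584004395432602016000, 87398881075798061929748708681662737475829760,
  1102235417387514211063496265447788275200, -3367755236771805066997405050479102548377600,
  -899839966119198297781488117623743099392, -213519748034116031486722181320494002890752,
  -14654880737804732310326593714189514342400],
  [1445086010555191575088201147032631575, -1445086010555191575088201147032631575, 0,
  -20268062207531486650967258205758368510596, 115762183564894445910192838391926080460800,
  -366579314167005406062443394720199133724672, 20268062207531486650967258205758368510596, 0, 0,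
  5245771676602821781448256194156670753177600, -1126061803635998935507859205244141407936,
  -115762183564894445910192838391926080460800, 366579314167005406062443394720199133724672,
  -5245771676602821781448256194156670753177600, 1126061803635998935507859205244141407936, 0, 0]]

def gp6 : List Q4 := [
  (20480, 0, 3, 12), (6400, 0, 9, 6), (32, 0, 13, 2), (152064, 1, 4, 10), (16896, 1, 8, 6),
  (208, 1, 12, 2), (152064, 2, 3, 10), (4938, 2, 9, 4), (8, 2, 13, 0), (88432, 3, 4, 8),
  (65421, 3, 8, 4), (52, 3, 12, 0), (149733, 4, 7, 4), (128, 4, 11, 0), (14592, 5, 0, 10),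
  (33168, 5, 2, 8), (103124, 5, 4, 6), (93618, 5, 6, 4), (156, 5, 10, 0), (121600, 6, 1, 8),
  (206248, 6, 3, 6), (108, 6, 9, 0), (11456, 7, 0, 8), (86228, 7, 2, 6), (3393, 7, 6, 2),
  (36, 7, 8, 0), (9423, 8, 5, 2), (9301, 9, 4, 2), (4368, 10, 1, 4), (3653, 10, 3, 2),
  (864, 11, 0, 4), (174, 11, 2, 2)]

def gn6 : List Q4 := [
  (14592, 0, 5, 10), (11456, 0, 7, 8), (864, 0, 11, 4), (121600, 1, 6, 8), (4368, 1, 10, 4),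
  (33168, 2, 5, 8), (86228, 2, 7, 6), (174, 2, 11, 2), (20480, 3, 0, 12), (152064, 3, 2, 10),
  (206248, 3, 6, 6), (3653, 3, 10, 2), (152064, 4, 1, 10), (88432, 4, 3, 8), (103124, 4, 5, 6),
  (9301, 4, 9, 2), (9423, 5, 8, 2), (93618, 6, 5, 4), (3393, 6, 7, 2), (149733, 7, 4, 4),
  (16896, 8, 1, 6), (65421, 8, 3, 4), (36, 8, 7, 0), (6400, 9, 0, 6), (4938, 9, 2, 4), (108, 9, 6, 0),
  (156, 10, 5, 0), (128, 11, 4, 0), (208, 12, 1, 2), (52, 12, 3, 0), (32, 13, 0, 2), (8, 13, 2, 0)]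

def cc6 : List (List ℤ) := [
  [0, 62139207040572244277074225921778830117510840320000,
  -510466678428614320816822116898001613574963200, 5986998691449393786113839647954608443728000,
  252449731491056353672150279240221081939000, 62139207040572244277074225921778830117510840320000,
  -510466678428614320816822116898001613574963200, 986951451987348622371822595627168008790865204032000,
  174797762151596123859497417363325474951659520, 2204470834775028422126992530895576550400,
  -1489738796940788352546553906801534343577600, -2925741735874395531070835440491627606720,
  -793618810235237469035887757361187139506176, 86452422089284981289539650963547051776000,
  5986998691449393786113839647954608443728000, -1489738796940788352546553906801534343577600,
  -2925741735874395531070835440491627606720, 571725149575508225828217212844843912964500,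
  3690125660072817528398785586325155104, -11929344601581703085079359688380015010372,
  -793618810235237469035887757361187139506176, 252449731491056353672150279240221081939000,
  86452422089284981289539650963547051776000, -11929344601581703085079359688380015010372,
  1395118710762830582102795087925664961520, -32759659319372903432261923370724043575,
  -32759659319372903432261923370724043575],
  [252449731491056353672150279240221081939000, 5986998691449393786113839647954608443728000,
  -510466678428614320816822116898001613574963200, -216869486391984159510059083069662646579200,
  946678376368126843611608970760892270340096, -7123788116433838495899107337834238957977600,
  3151963573391196168797206528112025915264, -87398881075798061929748708681662737475829760,
  -1102235417387514211063496265447788275200, 1020933356857228641633644233796003227149926400,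
  36366765612088081518990567152827560271080, -285862574787754112914108606422421956482250,
  -1845062830036408764199392793162577552, 8613526913374626848445661244635773301555200,
  -226221837516800637726371087620398308544, -11973997382898787572227679295909216887456000,
  -87398881075798061929748708681662737475829760, -1102235417387514211063496265447788275200,
  -153059566132889374575721213399705130833920, 8613526913374626848445661244635773301555200,
  -226221837516800637726371087620398308544, -7123788116433838495899107337834238957977600,
  3151963573391196168797206528112025915264, 14212200643853664353498659964813074425,
  -697559355381415291051397543962832480760, -24437421010506378433911207464447545260708,
  130417064302699178220519432106115594803200, -504899462982112707344300558480442163878000,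
  -153059566132889374575721213399705130833920, -285862574787754112914108606422421956482250,
  -1845062830036408764199392793162577552, 946678376368126843611608970760892270340096,
  130417064302699178220519432106115594803200, -216869486391984159510059083069662646579200,
  18547458675519239078763263405910969150, -24437421010506378433911207464447545260708,
  36366765612088081518990567152827560271080, -697559355381415291051397543962832480760,
  18547458675519239078763263405910969150, 14212200643853664353498659964813074425],
  [14212200643853664353498659964813074425, 18547458675519239078763263405910969150,
  -697559355381415291051397543962832480760, 36366765612088081518990567152827560271080,
  -24437421010506378433911207464447545260708, 18547458675519239078763263405910969150,
  -216869486391984159510059083069662646579200, 130417064302699178220519432106115594803200,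
  252449731491056353672150279240221081939000, 946678376368126843611608970760892270340096,
  -285862574787754112914108606422421956482250, -1845062830036408764199392793162577552,
  -153059566132889374575721213399705130833920, -504899462982112707344300558480442163878000,
  130417064302699178220519432106115594803200, -24437421010506378433911207464447545260708,
  -697559355381415291051397543962832480760, 14212200643853664353498659964813074425,
  -7123788116433838495899107337834238957977600, 3151963573391196168797206528112025915264,
  8613526913374626848445661244635773301555200, -226221837516800637726371087620398308544,
  -153059566132889374575721213399705130833920, 5986998691449393786113839647954608443728000,
  -493475725993674311185911297813584004395432602016000, -87398881075798061929748708681662737475829760,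
  -1102235417387514211063496265447788275200, -11973997382898787572227679295909216887456000,
  8613526913374626848445661244635773301555200, -226221837516800637726371087620398308544,
  -285862574787754112914108606422421956482250, -1845062830036408764199392793162577552,
  36366765612088081518990567152827560271080, -510466678428614320816822116898001613574963200,
  -124278414081144488554148451843557660235021680640000,
  1020933356857228641633644233796003227149926400,
  -493475725993674311185911297813584004395432602016000, -87398881075798061929748708681662737475829760,
  -1102235417387514211063496265447788275200, -7123788116433838495899107337834238957977600,
  3151963573391196168797206528112025915264, 946678376368126843611608970760892270340096,
  -216869486391984159510059083069662646579200],
  [-32759659319372903432261923370724043575, -32759659319372903432261923370724043575,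
  1395118710762830582102795087925664961520, -11929344601581703085079359688380015010372,
  86452422089284981289539650963547051776000, -793618810235237469035887757361187139506176,
  -11929344601581703085079359688380015010372, 571725149575508225828217212844843912964500,
  3690125660072817528398785586325155104, -1489738796940788352546553906801534343577600,
  -2925741735874395531070835440491627606720, 86452422089284981289539650963547051776000,
  -793618810235237469035887757361187139506176, -1489738796940788352546553906801534343577600,
  -2925741735874395531070835440491627606720, 174797762151596123859497417363325474951659520,
  2204470834775028422126992530895576550400]]

def wbig : ℕ := 0x454da638ede8df1484a0534cb6a0845c2cf2f8000000000000000000000000000000000000000cb298375fa7fbcb1b5299c6153a4dd88905fd00000000000000000000000000000000000000012b031eec86d1ded7579b2895ad16677f03bc100000000000000000000000000000000000000013e6c7ae16e4c2928179592421014d6dbdd8680000000000000000000000000000000000000000de9d8f372eef2f054a87477facf8bab216ff000000000000000000000000000000000000000000000000000000000000000000000000000000036bb7b1a7bfe655254eb796080a30c8e7ca800000000000000000000000000000000000000000d77d53554c94733bfb7be7c79cd1640802a8000000000000000000000000000000000000000030b1b7cbb63631f9d519f2a8e4dd81b9029400000000000000000000000000000000000000000ef3f3dc3008bdf5669ff7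f724837d7c07c1800000000000000000000000000000000000000000c939f5ba483c25e9b9e6b0d37b267a094a0003bf58ff89b87ab914225a738c97f03eb450900000000000000000000000000000000000000008fa6c44b7d1e054e93d50c9499bddee444048000000000000000000000000000000000000000a05a423a9e24b27cbda0e088bc7ab91a31467000000000000000000000000000000000000000811c6e083d5bfd1157d1eb8fccc7a9a06cf3c000000000000000000000000000000000000000454da638ede8df1484a0534cb6a0845c2cf2f800000000000000000000000000000000000000000000000000000000000000000000000000000000000000000000000000000000000000000000000000000000000000000000000000000000000000000000000000000000000000000000000000000000000000000000000000000000000000000000000000000000000000000000000000000000000000000000000000000000000000000000029555d5d55043f06a92200e04a52b31874e6000000000000000000000000000000000000000018cf5a4a674f2cbef960b5586f219dc447ed80000000000000000000000000000000000000000699e3d08f0f1e3d80f9dcd5e51ebaa88da5e0000000000000000000000000000000000000000119bc65d69fa3ad7ae68665de811da77da0980000000000000000000000000000000000000000247e00ef8b8bb4cae24218b344bc281ea86e000000000000000000000000000000000000000004273ad4074ffc67b34e7e002d23d7dbad6d80000000000000000000000000000000000000000091f8d7f9d37a711988da96b793eea8271fe000000000000000000000000000000000000000002e268da5e34b7c3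e2ce0606fe34c0c832518000000000000000000000000000000000000000018c76f526b887832fc3d9787c7350abf5f8e00000000000000000000000000000000000000000cfb211ec5beecc6eb5a082f9fa0518e42358000000000000000000000000000000000000000059d41fc9cadc66c1ec44844da60ecf26ef1e00000000000000000000000000000000000000001bc1171adbf5f5a634bc52dd8b018a389e9980000000000000000000000000000000000000000464963437920790147526b21036c9514ca4e00000000000000000000000000000000000000000a55575755410fc1aa4880381294acc61d39800000000000000000000000000000000000000000000000000000000000000000000000000000000000000000000000000000000000000000000000000000000000000000000000000000000000000000000000000000000000000000000000000000000000000000000000000000000000000000000000000000000000000000000000000000000000000000000000000000000000000000000000000000000000000000000000000000000000741810d9fa4cf349c8dcdfb98a8703ab41000000000000000000000000000000000000000000119c2fb1b04c8653870ae3bbb0990b6a3c4000000000000000000000000000000000000000000250bf4b7a49e6b6748227e4e39a97e2ecd00000000000000000000000000000000000000000004649ebad88f4debf462ca7bddef3f8d1e400000000000000000000000000000000000000000007731ada3c5f52ead1ce0844bbe27cd34500000000000000000000000000000000000000000000c53a652a923e15e5be6c865054a419bc400000000000000000000000000000000000000000002514bd7f319b34a192e37ddce1452c7fd0000000000000000000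00000000000000000000000012e0ce02ac8c87969a8d92b77ebf02b7a40000000000000000000000000000000000000000000b985410fbdf514478cc8ebe87b0c560350000000000000000000000000000000000000000000677de9b09bdee962110469ab1b998da18400000000000000000000000000000000000000000033b34313d8d1bb01e36051421e2024d52d000000000000000000000000000000000000000000175119f4176fe192fca10dd5099d662a864000000000000000000000000000000000000000000741810d9fa4cf349c8dcdfb98a8703ab410000000000000000000000000000000000000000000000000000000000000000000000000000000000000000000000000000000000000000000000000000000000000000000000000000000000000000000000000000000000000000000000000000000000000000000000000000000000000000000000000000000000000000000000000000000000000000000000000000000000000000000000000000000000000000000000000000000000000000000000000000000000000000000000000000000000000000000000000000000000000000000e86432f3509453c011e4291f8812b5f80000000000000000000000000000000000000000000021581ba3cee81d1b5729b1f422ddb912000000000000000000000000000000000000000000000404b1302984d34beb8a7a9a946051bc00000000000000000000000000000000000000000000006eb4b715215777135e4db54fcb168c60000000000000000000000000000000000000000000000a629240470fd8675d2c1c133a4420f000000000000000000000000000000000000000000000011611123a57ea90e0f6b142332191b20000000000000000000000000000000000000000000000644c46dda88f8ef6524d2874e8f26a000000000000000000000000000000000000000000000044f633dd8a2f58c5d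e43116f7b4da1e0000000000000000000000000000000000000000000002adb54495915545a9a4288e613b522500000000000000000000000000000000000000000000017762bd3eb1703d401f1e0b83d386a4a000000000000000000000000000000000000000000000b6e250c1461a6416b745787809c4cd20000000000000000000000000000000000000000000003a190cbcd42514f004790a47e204ad7e00000000000000000000000000000000000000000000000000000000000000000000000000000000000000000000000000000000000000000000000000000000000000000000000000000000000000000000000000000000000000000000000000000000000000000000000000000000000000000000000000000000000000000000000000000000000000000000000000000000000000000000000000000000000000000000000000000000000000000000000000000000000000000000000000000000000000000000000000000000000000000000000000000000000000000000000000000000000000000000000000000000000000000000000000000000000000000000000000000000000000000000000000000000000000000000000000000000000000000000000000000000000000000000000000000000000000000000000000000000000000000000000000000000000000000000000000000000000000000000000000000000000000000000000000000000000000000000000000000000000000000000000000000000000000000000000000000000000000000000000000000000000000000000000000000000000000000000000000000000000000000000000000000000000000000000000000000000000000000000000000000000000000000000000000000000000000000000000000000000000000000000000000000000000000000000000000000000000000000000000000000000000000000000000000000000000000000000000000000000000000000000000000000000000000000000000000000000000000000000000000000000000000000000000000000000000000000000000000000000000000000000000000000000000000000000000000000000000000000000000000000000000000000000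

def steps13 : List (Z3 × Z3) := [
  ((0, 1, 0), (-4, -3, 1)), ((-1, 0, 1), (0, 1, 0)), ((1, 0, 0), (-1, -4, 1)),
  ((1, 1, 0), (-1, 1, 1)), ((-2, 1, 0), (-4, 3, 1)), ((-1, 2, 0), (0, 2, 1)),
  ((-1, 2, 0), (-1, 0, 1)), ((-1, 1, 0), (1, 3, 1)), ((0, -2, 1), (1, 1, 0)), ((0, 1, 1), (-1, 1, 0)),
  ((0, -1, 1), (-2, 1, 0)), ((0, -1, 1), (1, 0, 0)), ((2, 1, 1), (1, 4, 0))]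

def steps14 : List (Z3 × Z3) := [
  ((-2, 1, 0), (6, -1, 2)), ((-1, 1, 0), (0, 1, 1)), ((1, 0, 0), (0, 1, 1)), ((0, 4, 1), (-1, 1, 0)),
  ((-4, 0, 1), (-1, 1, 0)), ((-1, 0, 1), (-1, 1, 0)), ((1, 1, 0), (2, 0, 1)), ((0, 1, 0), (-1, 0, 1)),
  ((-4, 0, 1), (0, 1, 0)), ((-1, 2, 0), (-1, 0, 1)), ((4, 0, 1), (0, 1, 0)), ((0, 2, 1), (-1, 1, 0)),
  ((-2, 0, 1), (-1, 1, 0)), ((-3, 2, 0), (-1, 0, 1))]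

def ext14 : List Z3 := [
  (4, 1, 3), (1, 2, 3), (-3, 7, 1)]

def rows14 : List Q4 := [
  (0, 0, 0, 0), (1, 0, 0, 0), (2, 0, 0, 0)]

def steps15 : List (Z3 × Z3) := [
  ((-2, 1, 0), (8, -3, 1)), ((1, 1, 0), (2, 0, 1)), ((0, 1, 0), (1, -1, 1)), ((1, 0, 0), (0, 1, 1)),
  ((0, 4, 1), (1, 0, 0)), ((0, -1, 1), (1, 0, 0)), ((4, 0, 1), (0, 1, 0)), ((0, -4, 1), (1, 0, 0)),
  ((-4, 0, 1), (0, 1, 0)), ((-1, 0, 1), (0, 1, 0)), ((0, 0, 1), (1, 1, 0)), ((-1, 2, 0), (1, 0, 1)),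
  ((-2, 0, 1), (1, 1, 0)), ((-1, 1, 0), (-4, 0, 1)), ((-2, 3, 0), (0, 0, 1))]

def ext15 : List Z3 := [
  (4, 1, 3), (6, -1, 2), (-3, -5, 1), (-1, -5, 2), (1, 5, 1), (1, -6, 1), (5, 1, 1), (-6, 1, 1),
  (3, 4, 1), (5, 4, 1), (4, 3, 1), (-4, -3, 1)]

def rows15 : List Q4 := [
  (0, 0, 0, 1), (0, 0, 1, 0), (0, 1, 0, 0), (1, 0, 0, 1), (1, 0, 1, 0), (1, 1, 0, 0), (2, 0, 1, 0),
  (2, 1, 0, 0), (3, 0, 0, 0), (4, 0, 0, 0), (5, 0, 0, 0), (6, 0, 0, 0)]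

def steps16 : List (Z3 × Z3) := [
  ((1, 0, 0), (6, 1, 1)), ((-1, 1, 0), (3, 1, 1)), ((0, 1, 1), (-1, 1, 0)), ((1, 1, 0), (3, 1, 1)),
  ((-1, 0, 1), (-1, 1, 0)), ((-2, 1, 0), (0, 1, 1)), ((-4, 0, 1), (-1, 1, 0)),
  ((0, 1, 0), (-4, 0, 1)), ((1, 0, 1), (0, 1, 0)), ((-1, 0, 1), (0, 1, 0)), ((4, 0, 1), (0, 1, 0)),
  ((0, -1, 1), (1, 0, 0)), ((-2, 0, 1), (1, 1, 0)), ((0, 0, 1), (-1, 2, 1)), ((-4, 1, 0), (2, 1, 1)),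
  ((1, 2, 0), (3, 0, 1))]

def ext16 : List Z3 := [
  (5, 1, 1), (-6, 1, 1), (3, 2, 2), (-3, 7, 1), (1, 7, 2), (3, 5, 2), (1, 2, 3), (2, 1, 3),
  (-1, 4, 3), (-3, -5, 1), (-1, -5, 2), (-2, -1, 3), (-1, -2, 3), (4, 1, 3), (6, -1, 2), (-7, -1, 2),
  (-4, -3, 1), (-4, -5, 1), (1, 5, 1), (1, -6, 1), (1, 6, 1), (-1, -5, 1), (4, 3, 1), (-5, -1, 1),
  (-4, 1, 0), (0, 3, 2), (1, 2, 0)]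

def rows16 : List Q4 := [
  (0, 0, 0, 2), (0, 1, 0, 1), (0, 2, 0, 0), (0, 0, 1, 1), (0, 0, 2, 0), (1, 0, 0, 2), (0, 1, 1, 0),
  (1, 1, 0, 1), (2, 0, 2, 0), (1, 0, 1, 1), (1, 0, 2, 0), (1, 2, 0, 0), (2, 1, 1, 0), (1, 1, 1, 0),
  (2, 2, 0, 0), (3, 0, 0, 1), (3, 0, 1, 0), (3, 1, 0, 0), (4, 0, 0, 1), (4, 0, 1, 0), (4, 1, 0, 0),
  (5, 0, 0, 1), (5, 0, 1, 0), (5, 1, 0, 0), (6, 0, 1, 0), (6, 0, 0, 1), (6, 1, 0, 0)]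

def inv14 : List (List ℕ) := [
  [13, 11, 2],
  [13, 14, 0],
  [0, 15, 17]]

def prm14 : ℕ := 19

def inv15 : List (List ℕ) := [
  [11, 4, 17, 14, 3, 4, 9, 3, 10, 4, 13, 14],
  [0, 0, 13, 8, 9, 12, 10, 13, 1, 16, 0, 0],
  [0, 0, 0, 0, 0, 0, 1, 1, 1, 16, 0, 0],
  [6, 1, 4, 15, 1, 7, 1, 15, 9, 9, 13, 5],
  [17, 5, 2, 10, 17, 16, 3, 3, 1, 16, 9, 0],
  [11, 1, 8, 2, 11, 7, 12, 12, 4, 7, 13, 15],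
  [17, 5, 2, 10, 2, 1, 3, 3, 1, 16, 9, 0],
  [0, 0, 0, 0, 0, 0, 14, 14, 18, 3, 0, 0],
  [12, 11, 6, 12, 4, 12, 1, 18, 5, 12, 2, 0],
  [4, 13, 11, 16, 9, 4, 4, 2, 0, 11, 3, 14],
  [6, 4, 16, 4, 13, 4, 6, 13, 6, 4, 14, 2],
  [18, 8, 12, 8, 14, 5, 9, 11, 13, 17, 12, 2]]

def prm15 : ℕ := 19

def inv16 : List (List ℕ) := [
  [15, 10, 15, 13, 21, 11, 8, 21, 15, 8, 17, 12, 11, 10, 8, 1, 14, 8, 13, 18, 0, 9, 12, 4, 2, 22, 4],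
  [22, 4, 8, 20, 13, 19, 21, 14, 1, 10, 1, 19, 12, 12, 4, 10, 15, 3, 1, 15, 20, 16, 15, 20, 18, 0, 7],
  [22, 14, 15, 1, 0, 19, 7, 0, 10, 5, 8, 3, 14, 8, 1, 12, 8, 15, 13, 8, 5, 15, 2, 1, 0, 0, 0],
  [22, 11, 14, 19, 2, 2, 18, 22, 22, 1, 15, 22, 0, 18, 20, 2, 5, 16, 13, 22, 12, 4, 21, 18, 14, 0, 5],
  [21, 21, 13, 15, 16, 1, 11, 4, 11, 2, 2, 4, 20, 12, 6, 2, 2, 17, 18, 5, 0, 14, 19, 14, 0, 0, 0],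
  [13, 9, 13, 2, 13, 1, 12, 16, 11, 22, 11, 18, 2, 7, 18, 9, 22, 5, 6, 13, 20, 13, 8, 17, 1, 11, 2],
  [6, 14, 10, 22, 2, 8, 18, 0, 6, 15, 11, 11, 13, 14, 19, 21, 14, 9, 3, 20, 22, 9, 15, 5, 0, 0, 0],
  [6, 13, 7, 1, 11, 16, 18, 18, 22, 2, 21, 11, 15, 16, 3, 8, 9, 17, 7, 16, 10, 9, 11, 14, 9, 0, 15],
  [6, 10, 22, 20, 3, 2, 13, 4, 21, 0, 0, 13, 16, 1, 20, 0, 22, 14, 11, 22, 19, 0, 0, 0, 0, 0, 0],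
  [8, 2, 13, 7, 9, 3, 7, 10, 4, 15, 18, 11, 17, 2, 12, 11, 2, 1, 8, 1, 4, 19, 3, 11, 7, 0, 14],
  [6, 10, 22, 20, 3, 2, 13, 4, 21, 0, 0, 13, 16, 1, 20, 0, 22, 14, 2, 4, 16, 0, 0, 0, 0, 0, 0],
  [7, 3, 1, 6, 10, 20, 20, 11, 20, 3, 6, 1, 22, 20, 15, 10, 5, 12, 20, 7, 21, 1, 6, 10, 0, 0, 0],
  [3, 4, 21, 17, 5, 15, 18, 12, 8, 18, 15, 10, 2, 16, 19, 11, 14, 22, 21, 14, 14, 8, 21, 22, 0, 0, 0],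
  [22, 15, 5, 7, 1, 19, 12, 20, 14, 11, 7, 18, 17, 15, 1, 17, 8, 3, 17, 18, 8, 4, 0, 0, 0, 0, 0],
  [20, 17, 22, 22, 0, 4, 16, 0, 13, 18, 15, 20, 9, 15, 22, 11, 15, 8, 10, 15, 18, 8, 21, 22, 0, 0, 0],
  [3, 13, 20, 22, 16, 12, 0, 14, 7, 6, 14, 13, 14, 1, 16, 20, 1, 6, 20, 22, 12, 4, 22, 11, 19, 2, 15],
  [8, 12, 19, 17, 9, 3, 17, 2, 20, 22, 4, 20, 9, 4, 10, 1, 2, 1, 6, 3, 14, 9, 13, 14, 18, 0, 13],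
  [19, 19, 11, 16, 6, 4, 0, 20, 20, 16, 1, 22, 11, 6, 15, 4, 13, 1, 20, 6, 7, 0, 19, 16, 10, 0, 9],
  [14, 21, 6, 17, 13, 14, 2, 16, 5, 3, 19, 20, 17, 11, 3, 22, 13, 13, 9, 6, 10, 9, 10, 15, 4, 21, 8],
  [0, 16, 0, 19, 11, 15, 3, 13, 5, 21, 21, 17, 6, 6, 2, 0, 2, 11, 20, 0, 16, 21, 6, 10, 5, 0, 10],
  [0, 13, 10, 0, 22, 13, 13, 11, 12, 21, 4, 11, 19, 22, 5, 12, 9, 16, 21, 19, 13, 2, 16, 16, 13, 0, 14],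
  [8, 20, 8, 15, 17, 10, 6, 12, 17, 16, 21, 9, 17, 9, 9, 20, 20, 12, 6, 21, 10, 7, 7, 14, 10, 18, 20],
  [20, 16, 9, 15, 0, 22, 13, 1, 10, 15, 0, 15, 11, 10, 20, 9, 20, 20, 18, 6, 21, 5, 15, 6, 1, 0, 2],
  [9, 1, 18, 7, 13, 11, 2, 9, 21, 14, 1, 8, 19, 17, 11, 0, 12, 0, 4, 7, 11, 12, 14, 15, 21, 0, 12],
  [14, 12, 21, 21, 21, 22, 12, 12, 1, 3, 11, 21, 11, 2, 20, 19, 3, 9, 21, 0, 17, 19, 7, 4, 15, 0, 7],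
  [17, 0, 21, 1, 12, 5, 12, 7, 12, 10, 9, 7, 18, 13, 9, 18, 16, 1, 3, 17, 16, 0, 16, 2, 12, 17, 1],
  [16, 20, 22, 4, 5, 13, 0, 4, 4, 20, 0, 15, 16, 8, 10, 3, 10, 17, 11, 8, 1, 20, 7, 7, 16, 0, 19]]

def prm16 : ℕ := 23

def gGp : List Q4 := [
  (8822784, 0, 0, 12), (12621824, 0, 4, 8), (248312, 0, 8, 4), (25243648, 1, 3, 8), (993248, 1, 7, 4),
  (37865472, 2, 2, 8), (2393662, 2, 6, 4), (25243648, 3, 1, 8), (3704618, 3, 5, 4), (7360, 3, 9, 0),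
  (12621824, 4, 0, 8), (4360096, 4, 4, 4), (16799, 4, 8, 0), (3704618, 5, 3, 4), (7196, 5, 7, 0),
  (2393662, 6, 2, 4), (993248, 7, 1, 4), (7196, 7, 5, 0), (248312, 8, 0, 4), (16799, 8, 4, 0),
  (7360, 9, 3, 0)]

def gGn : List Q4 := [
  (19802624, 0, 2, 10), (2988864, 0, 6, 6), (2792, 0, 10, 2), (240, 0, 12, 0), (19802624, 1, 1, 10),
  (8966592, 1, 5, 6), (13960, 1, 9, 2), (1440, 1, 11, 0), (19802624, 2, 0, 10), (16047576, 2, 4, 6),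
  (77146, 2, 8, 2), (1168, 2, 10, 0), (17150832, 3, 3, 6), (224824, 3, 7, 2), (16047576, 4, 2, 6),
  (407768, 4, 6, 2), (8966592, 5, 1, 6), (495052, 5, 5, 2), (2988864, 6, 0, 6), (407768, 6, 4, 2),
  (4790, 6, 6, 0), (224824, 7, 3, 2), (77146, 8, 2, 2), (13960, 9, 1, 2), (2792, 10, 0, 2),
  (1168, 10, 2, 0), (1440, 11, 1, 0), (240, 12, 0, 0)]

theorem eval_hom {g : PolyQ} {d : ℕ} (hg : g.IsHomogeneous d) (c : ℚ) (x : Fin 3 → ℚ) :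
    eval (c • x) g = c ^ d * eval x g := by
  rw [eval_eq, eval_eq, Finset.mul_sum]
  refine Finset.sum_congr rfl fun m hm => ?_
  have h1 : m.degree = d := by
    by_contra h
    exact (mem_support_iff.mp hm) (hg.coeff_eq_zero h)
  have h2 : d = ∑ i ∈ m.support, m i := by rw [← h1, Finsupp.degree_apply]
  simp only [Pi.smul_apply, smul_eq_mul, mul_pow, Finset.prod_mul_distrib]
  rw [Finset.prod_pow_eq_pow_sum, h2]
  ring

theorem hom_factor {N k g : PolyQ} {d : ℕ} (hN : N.IsHomogeneous 1) (hg : g.IsHomogeneous (d + 1))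
    (h : g = N * k) : ∃ k', k'.IsHomogeneous d ∧ g = N * k' := by
  refine ⟨homogeneousComponent d k, homogeneousComponent_isHomogeneous d k, ?_⟩
  have h1 : homogeneousComponent (d + 1) g = g := homogeneousComponent_eq_self hg
  have h2 : homogeneousComponent (d + 1) (N * k) = N * homogeneousComponent d k := by
    conv_lhs => rw [← sum_homogeneousComponent k, Finset.mul_sum, map_sum]
    have h3 : ∀ i ∈ Finset.range (k.totalDegree + 1),
        homogeneousComponent (d + 1) (N * homogeneousComponent i k) =
          if i = d then N * homogeneousComponent d k else 0 := by
      intro i _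
      have h4 : (N * homogeneousComponent i k) ∈ homogeneousSubmodule (Fin 3) ℚ (1 + i) :=
        hN.mul (homogeneousComponent_isHomogeneous i k)
      rw [homogeneousComponent_of_mem h4]
      by_cases h : i = d
      · subst h
        rw [if_pos (by omega), if_pos rfl]
      · rw [if_neg (by omega), if_neg h]
    rw [Finset.sum_congr rfl h3, Finset.sum_ite_eq']
    split_ifs with h5
    · rfl
    · rw [homogeneousComponent_eq_zero, mul_zero]
      simpa using h5
  rw [← h1, h, h2]

/-- linear form -/
noncomputable def lf (n : Fin 3 → ℚ) : PolyQ := C (n 0) * X 0 + C (n 1) * X 1 + C (n 2) * X 2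

def dt (n x : Fin 3 → ℚ) : ℚ := n 0 * x 0 + n 1 * x 1 + n 2 * x 2

theorem eval_lf (n x : Fin 3 → ℚ) : eval x (lf n) = dt n x := by simp [lf, dt]

theorem lf_hom (n : Fin 3 → ℚ) : (lf n).IsHomogeneous 1 := by
  unfold lf
  exact ((isHomogeneous_C_mul_X _ _).add (isHomogeneous_C_mul_X _ _)).add (isHomogeneous_C_mul_X _ _)

def crs (p q : Fin 3 → ℚ) : Fin 3 → ℚ :=
  ![p 1 * q 2 - p 2 * q 1, p 2 * q 0 - p 0 * q 2, p 0 * q 1 - p 1 * q 0]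

theorem crs_id (l p q r : Fin 3 → ℚ) (h : dt (crs p q) r = 0) :
    dt l (crs p q) • r = dt l (crs r q) • p + dt l (crs p r) • q := by
  simp only [dt, crs, Matrix.cons_val_zero, Matrix.cons_val_one, Matrix.cons_val] at h
  funext i
  fin_cases i <;> simp [dt, crs]
  · linear_combination (l 0) * h
  · linear_combination (l 1) * h
  · linear_combination (l 2) * h

/-- A form of degree `d` with `d+1` zeros on a line is divisible by the equation of the line. -/
theorem line_div {g : PolyQ} {d : ℕ} (hg : g.IsHomogeneous (d + 1)) (l p q : Fin 3 → ℚ)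
    (hl : dt l (crs p q) ≠ 0) (T : Finset ℚ) (hT : d + 1 < T.card)
    (h0 : ∀ t ∈ T, eval (p + t • q) g = 0) :
    ∃ k, k.IsHomogeneous d ∧ g = lf (crs p q) * k := by
  set n := crs p q with hn
  -- univariate restriction
  let h : Polynomial ℚ := aeval (fun i => Polynomial.C (p i) + Polynomial.C (q i) * Polynomial.X) g
  have hev : ∀ t, h.eval t = eval (p + t • q) g := by
    intro t
    have : h.eval t = (Polynomial.aeval t : Polynomial ℚ →ₐ[ℚ] ℚ) h := by
      rw [Polynomial.coe_aeval_eq_eval]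
    rw [this]
    show (Polynomial.aeval t) (aeval _ g) = _
    rw [← AlgHom.comp_apply, comp_aeval, ← MvPolynomial.coe_aeval_eq_eval, RingHom.coe_coe]
    congr 2
    funext i
    simp; ring
  have hdeg : h.natDegree ≤ d + 1 := by
    have := MvPolynomial.aeval_natDegree_le (m := d + 1) (n := 1) g hg.totalDegree_le
      (fun i => Polynomial.C (p i) + Polynomial.C (q i) * Polynomial.X) (fun i => by compute_degree)
    simpa using this
  have hz : h = 0 := by
    refine Polynomial.eq_zero_of_natDegree_lt_card_of_eval_eq_zero' h T ?_ (by omega)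
    intro t ht
    rw [hev]; exact h0 t ht
  have hline : ∀ t : ℚ, eval (p + t • q) g = 0 := by intro t; rw [← hev, hz]; simp
  have hon : ∀ x, dt n x = 0 → dt l (crs x q) ≠ 0 → eval x g = 0 := by
    intro x hx hx2
    have h1 := crs_id l p q x hx
    have h2 : p + (dt l (crs p x) / dt l (crs x q)) • q = (dt l n / dt l (crs x q)) • x := by
      rw [div_eq_inv_mul (dt l n), mul_smul, h1, smul_add, smul_smul, smul_smul, inv_mul_cancel₀ hx2,
        one_smul, div_eq_inv_mul]
    have h3 := hline (dt l (crs p x) / dt l (crs x q))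
    rw [h2, eval_hom hg] at h3
    have h4 : (dt l n / dt l (crs x q)) ^ (d + 1) ≠ 0 := pow_ne_zero _ (div_ne_zero hl hx2)
    exact (mul_eq_zero.mp h3).resolve_left h4
  -- projection to the line
  let φ : Fin 3 → PolyQ := fun i => X i - C (l i / dt l n) * lf n
  let pr : (Fin 3 → ℚ) → (Fin 3 → ℚ) := fun x i => x i - (l i / dt l n) * dt n x
  have hdt : ∀ x y, dt x y = dt y x := by intro x y; simp [dt]; ring
  have hpr : ∀ x, dt n (pr x) = 0 := by
    intro x
    have : dt n (pr x) = dt n x - (dt l n / dt l n) * dt n x := by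
      simp only [dt, pr]; ring
    rw [this, div_self hl]; ring
  have hevφ : ∀ x f, eval x (aeval φ f) = eval (pr x) f := by
    intro x f
    rw [← MvPolynomial.coe_aeval_eq_eval, ← MvPolynomial.coe_aeval_eq_eval]
    show (aeval x) (aeval φ f) = (aeval (pr x)) f
    rw [← AlgHom.comp_apply, comp_aeval]
    congr 2
    funext i
    simp only [φ, pr, map_sub, map_mul, aeval_X, aeval_C, Algebra.algebraMap_self, RingHom.id_apply]
    rw [show aeval x (lf n) = dt n x from by
      rw [← eval_lf, ← MvPolynomial.coe_aeval_eq_eval]; rfl]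
  let L : PolyQ := aeval φ (lf (crs q l))
  have hcl : ∀ x, dt l (crs x q) = dt (crs q l) x := by
    intro x; simp [dt, crs]; ring
  have hL : L * aeval φ g = 0 := by
    apply MvPolynomial.funext
    intro x
    rw [map_mul, hevφ, hevφ, eval_lf, ← hcl, map_zero]
    by_cases h : dt l (crs (pr x) q) = 0
    · rw [h, zero_mul]
    · rw [hon _ (hpr x) h, mul_zero]
  have hL0 : L ≠ 0 := by
    intro h
    have h1 := congrArg (eval p) h
    rw [hevφ, eval_lf, ← hcl, map_zero] at h1
    have h2 : pr p = p := by
      funext i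
      have : dt n p = 0 := by rw [hn]; simp [dt, crs]; ring
      simp [pr, this]
    rw [h2] at h1
    exact hl h1
  have hφg : aeval φ g = 0 := (mul_eq_zero.mp hL).resolve_left hL0
  have hdiv : ∀ f : PolyQ, lf n ∣ f - aeval φ f := by
    intro f
    induction f using MvPolynomial.induction_on with
    | C a => simp
    | add a b ha hb =>
      have := dvd_add ha hb
      rw [map_add]
      convert this using 1; ring
    | mul_X a i ha =>
      rw [map_mul, aeval_X]
      have : a * X i - aeval φ a * φ i = (a - aeval φ a) * X i + aeval φ a * (X i - φ i) := by ring
      rw [this]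
      refine dvd_add (ha.mul_right _) (Dvd.dvd.mul_left ?_ _)
      simp only [φ]
      exact ⟨C (l i / dt l n), by ring⟩
  obtain ⟨k, hk⟩ := hdiv g
  rw [hφg, sub_zero] at hk
  exact hom_factor (lf_hom n) hg hk

def pt (q : Z3) : Fin 3 → ℚ := ![(q.1 : ℚ), (q.2.1 : ℚ), (q.2.2 : ℚ)]

def crsZ (p q : Z3) : Z3 :=
  (p.2.1 * q.2.2 - p.2.2 * q.2.1, p.2.2 * q.1 - p.1 * q.2.2, p.1 * q.2.1 - p.2.1 * q.1)
def dtZ (p q : Z3) : ℤ := p.1 * q.1 + p.2.1 * q.2.1 + p.2.2 * q.2.2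

theorem pt_crs (p q : Z3) : pt (crsZ p q) = crs (pt p) (pt q) := by
  funext i; fin_cases i <;> simp [pt, crsZ, crs]
theorem pt_dt (p q : Z3) : ((dtZ p q : ℤ) : ℚ) = dt (pt p) (pt q) := by
  simp [pt, dtZ, dt]

def lamZ : Z3 := (3, 7, 31)

/-- parameters of the points of the list lying on the line `pq`. -/
def tausZ (p q n : Z3) : List Z3 → List (ℤ × ℤ)
  | [] => []
  | r :: rs =>
    if dtZ n r = 0 then
      if dtZ lamZ (crsZ r q) = 0 then tausZ p q n rs
      else (dtZ lamZ (crsZ p r), dtZ lamZ (crsZ r q)) :: tausZ p q n rs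
    else tausZ p q n rs

def distinctZ : List (ℤ × ℤ) → Bool
  | [] => true
  | a :: l => (l.all fun b => a.1 * b.2 != b.1 * a.2) && distinctZ l

def peel : ℕ → List Z3 → List (Z3 × Z3) → Bool
  | 0, pts, _ => !pts.isEmpty
  | _ + 1, _, [] => false
  | d + 1, pts, s :: st =>
    dtZ lamZ (crsZ s.1 s.2) != 0 &&
    (Nat.blt (d + 1) (tausZ s.1 s.2 (crsZ s.1 s.2) pts).length &&
    (distinctZ (tausZ s.1 s.2 (crsZ s.1 s.2) pts) &&
    peel d (pts.filter fun r => dtZ (crsZ s.1 s.2) r != 0) st))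

theorem taus_spec (p q : Z3) (pts : List Z3) (t : ℤ × ℤ)
    (ht : t ∈ tausZ p q (crsZ p q) pts) : t.2 ≠ 0 ∧ ∃ r ∈ pts, dtZ (crsZ p q) r = 0 ∧
      t = (dtZ lamZ (crsZ p r), dtZ lamZ (crsZ r q)) := by
  induction pts with
  | nil => simp [tausZ] at ht
  | cons r rs ih =>
    rw [tausZ] at ht
    have key : t ∈ tausZ p q (crsZ p q) rs → t.2 ≠ 0 ∧ ∃ r' ∈ r :: rs, dtZ (crsZ p q) r' = 0 ∧
        t = (dtZ lamZ (crsZ p r'), dtZ lamZ (crsZ r' q)) := by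
      intro h
      obtain ⟨h1, r', h2, h3⟩ := ih h
      exact ⟨h1, r', List.mem_cons_of_mem _ h2, h3⟩
    split_ifs at ht with h1 h2
    · exact key ht
    · rcases List.mem_cons.mp ht with h | h
      · exact ⟨by rw [h]; exact h2, r, List.mem_cons_self, h1, h⟩
      · exact key h
    · exact key ht

theorem distinct_spec (l : List (ℤ × ℤ)) (h0 : ∀ t ∈ l, t.2 ≠ 0) (h : distinctZ l = true) :
    (l.map fun t => (t.1 : ℚ) / (t.2 : ℚ)).Nodup := by
  induction l with
  | nil => simp
  | cons a l ih =>
    rw [distinctZ, Bool.and_eq_true, List.all_eq_true] at h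
    rw [List.map_cons, List.nodup_cons]
    refine ⟨?_, ih (fun t ht => h0 t (List.mem_cons_of_mem _ ht)) h.2⟩
    intro hm
    obtain ⟨b, hb, hab⟩ := List.mem_map.mp hm
    have h1 := h.1 b hb
    have ha0 : (a.2 : ℚ) ≠ 0 := by exact_mod_cast h0 a List.mem_cons_self
    have hb0 : (b.2 : ℚ) ≠ 0 := by exact_mod_cast h0 b (List.mem_cons_of_mem _ hb)
    rw [div_eq_div_iff hb0 ha0] at hab
    have : a.1 * b.2 = b.1 * a.2 := by exact_mod_cast hab.symm
    simp [this] at h1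

theorem peel_spec (d : ℕ) : ∀ (pts : List Z3) (st : List (Z3 × Z3)) (g : PolyQ),
    peel d pts st = true → g.IsHomogeneous d → (∀ q ∈ pts, eval (pt q) g = 0) → g = 0 := by
  induction d with
  | zero =>
    intro pts st g hp hg h0
    rcases pts with _ | ⟨q, pts⟩
    · simp [peel] at hp
    · have h1 := h0 q List.mem_cons_self
      have h2 : g = C (coeff 0 g) := totalDegree_eq_zero_iff_eq_C.mp
        (Nat.le_zero.mp hg.totalDegree_le)
      rw [h2, eval_C] at h1
      rw [h2, h1, C_0]
  | succ d ih =>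
    intro pts st g hp hg h0
    rcases st with _ | ⟨⟨p, q⟩, st⟩
    · simp [peel] at hp
    · simp only [peel, Bool.and_eq_true] at hp
      obtain ⟨h1, h2, h3, h4⟩ := hp
      have hl : dt (pt lamZ) (crs (pt p) (pt q)) ≠ 0 := by
        rw [← pt_crs, ← pt_dt]
        simpa using h1
      have hsp := taus_spec p q pts
      set ts := tausZ p q (crsZ p q) pts with hts
      have hnd := distinct_spec ts (fun t ht => (hsp t ht).1) h3
      obtain ⟨k, hk, hgk⟩ := line_div hg (pt lamZ) (pt p) (pt q) hl
        (ts.map fun t => (t.1 : ℚ) / (t.2 : ℚ)).toFinset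
        (by rw [List.toFinset_card_of_nodup hnd, List.length_map]; simpa using h2)
        (by
          intro t ht
          rw [List.mem_toFinset, List.mem_map] at ht
          obtain ⟨a, ha, rfl⟩ := ht
          obtain ⟨ha2, r, hr, hnr, har⟩ := hsp a ha
          have e1 := crs_id (pt lamZ) (pt p) (pt q) (pt r)
            (by rw [← pt_crs, ← pt_dt, hnr]; simp)
          rw [← pt_crs r q, ← pt_crs p r, ← pt_dt lamZ (crsZ r q), ← pt_dt lamZ (crsZ p r)] at e1
          have e2 : (dtZ lamZ (crsZ r q) : ℚ) = (a.2 : ℚ) := by rw [har]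
          have e3 : (dtZ lamZ (crsZ p r) : ℚ) = (a.1 : ℚ) := by rw [har]
          rw [e2, e3] at e1
          have ha0 : (a.2 : ℚ) ≠ 0 := by exact_mod_cast ha2
          have e4 : pt p + ((a.1 : ℚ) / (a.2 : ℚ)) • pt q
              = (dt (pt lamZ) (crs (pt p) (pt q)) / (a.2 : ℚ)) • pt r := by
            rw [div_eq_inv_mul (dt _ _), mul_smul, e1, smul_add, smul_smul, smul_smul,
              inv_mul_cancel₀ ha0, one_smul, div_eq_inv_mul]
          rw [e4, eval_hom hg, h0 r hr, mul_zero])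
      have hk0 : k = 0 := by
        refine ih _ st k h4 hk ?_
        intro r hr
        rw [List.mem_filter] at hr
        have h5 := h0 r hr.1
        rw [hgk, map_mul, eval_lf, ← pt_crs, ← pt_dt] at h5
        refine (mul_eq_zero.mp h5).resolve_left ?_
        have := hr.2
        simpa using this
      rw [hgk, hk0, mul_zero]

noncomputable section

def wdig (a b : ℕ) : ℕ :=
  Nat.mul (Nat.mod (Nat.add a b) 2) (Nat.mod (Nat.shiftRight wbig (Nat.mul 153
    (Nat.add (Nat.mul 34 (Nat.sub (Nat.div (Nat.add a b) 2) 11)) a))) (Nat.pow 2 153))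

def wf (a b : ℕ) : ℤ := (wdig a b : ℤ) - (wdig b a : ℤ)

def ellN (l : List Q4) (i j : ℕ) : ℕ :=
  List.rec 0 (fun t _ acc =>
    Nat.add (Nat.mul t.1 (wdig (Nat.add t.2.1 i) (Nat.add t.2.2.1 j))) acc) l
def ellS (l : List Q4) (i j : ℕ) : ℕ :=
  List.rec 0 (fun t _ acc =>
    Nat.add (Nat.mul t.1 (wdig (Nat.add t.2.2.1 j) (Nat.add t.2.1 i))) acc) l

def magN (p : ℕ × ℕ × ℕ) (i j k : ℕ) : ℕ :=
  Nat.mul (Nat.pow p.1 i) (Nat.mul (Nat.pow p.2.1 j) (Nat.pow p.2.2 k))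

def posN (i j k : ℕ) (cs : List ℤ) : List (ℕ × ℕ × ℕ) → ℕ :=
  List.rec (fun _ => 0) (fun c _ ih ps => List.rec 0 (fun p ps' _ =>
    Int.rec (fun m => Nat.add (Nat.mul m (magN p i j k)) (ih ps')) (fun _ => ih ps') c) ps) cs
def negN (i j k : ℕ) (cs : List ℤ) : List (ℕ × ℕ × ℕ) → ℕ :=
  List.rec (fun _ => 0) (fun c _ ih ps => List.rec 0 (fun p ps' _ =>
    Int.rec (fun _ => ih ps')
      (fun m => Nat.add (Nat.mul (Nat.succ m) (magN p i j k)) (ih ps')) c) ps) cs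

def pcls : List (ℕ × ℕ × List (ℕ × ℕ × ℕ)) :=
  [(0, 0, pc0), (0, 1, pc1), (1, 0, pc2), (1, 1, pc3)]

def clsSum (i j k : ℕ) : List (List ℤ) → List (ℕ × ℕ × List (ℕ × ℕ × ℕ)) → ℤ
  | c :: cs, p :: ps => (-1) ^ (p.1 * i + p.2.1 * j) *
      ((posN i j k c p.2.2 : ℤ) - (negN i j k c p.2.2 : ℤ)) + clsSum i j k cs ps
  | _, _ => 0

def cert (gp gn : List Q4) (D : ℕ) (cc : List (List ℤ)) (n : ℕ) : Bool :=
  (List.range (n + 1)).all fun i => (List.range (n + 1 - i)).all fun j =>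
    (D : ℤ) * (((ellN gp i j + ellS gn i j : ℕ) : ℤ) - ((ellS gp i j + ellN gn i j : ℕ) : ℤ)) ==
      clsSum i j (n - i - j) cc pcls


def sgnN (x : ℤ) : ℕ := Int.rec (fun _ => 0) (fun _ => 1) x
def absN (x : ℤ) : ℕ := Int.rec (fun m => m) (fun m => Nat.succ m) x

/-- partial evaluation: the terms of sign parity `r` -/
def evA (r su sv sz u v z : ℕ) (l : List Q4) : ℕ :=
  List.rec 0 (fun t _ acc => Nat.rec
    (Nat.add (Nat.mul t.1 (magN (u, v, z) t.2.1 t.2.2.1 t.2.2.2)) acc) (fun _ _ => acc)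
    (Nat.mod (Nat.add r (Nat.add (Nat.mul su t.2.1) (Nat.add (Nat.mul sv t.2.2.1)
      (Nat.mul sz t.2.2.2)))) 2)) l

def evPN (r : ℕ) (q : Z3) (l : List Q4) : ℕ :=
  evA r (sgnN q.1) (sgnN q.2.1) (sgnN q.2.2) (absN q.1) (absN q.2.1) (absN q.2.2) l

def evP (gp gn : List Q4) (q : Z3) : ℕ := Nat.add (evPN 0 q gp) (evPN 1 q gn)
def evM (gp gn : List Q4) (q : Z3) : ℕ := Nat.add (evPN 1 q gp) (evPN 0 q gn)

def vanish (g : List Q4 × List Q4) : Bool :=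
  ptsZ.all fun q => Nat.beq (evP g.1 g.2 q) (evM g.1 g.2 q)

def gensZ : List (List Q4 × List Q4) :=
  [(gp0, gn0), (gp1, gn1), (gp2, gn2), (gp3, gn3), (gp4, gn4), (gp5, gn5), (gp6, gn6)]

/-- value of the row `t` (a monomial times a generator) at the point `e` -/
def rowVal (t : Q4) (e : Z3) : ℤ :=
  (e.1 ^ t.2.1 * e.2.1 ^ t.2.2.1 * e.2.2 ^ t.2.2.2) *
    Int.subNatNat (evP (gensZ.getD t.1 ([], [])).1 (gensZ.getD t.1 ([], [])).2 e)
      (evM (gensZ.getD t.1 ([], [])).1 (gensZ.getD t.1 ([], [])).2 e)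

def forceN (x : ℕ) (k : ℕ → Bool) : Bool :=
  Nat.rec (motive := fun _ => Bool) (k 0) (fun n _ => k (Nat.succ n)) x
def forceL (l : List ℕ) : (List ℕ → Bool) → Bool :=
  List.rec (fun k => k []) (fun x _ ih k => forceN x fun y => ih fun ys => k (y :: ys)) l
def forceLL (l : List (List ℕ)) : (List (List ℕ) → Bool) → Bool :=
  List.rec (fun k => k []) (fun x _ ih k => forceL x fun y => ih fun ys => k (y :: ys)) l

def modN (p : ℕ) (x : ℤ) : ℕ := (x % (p : ℤ)).toNat

def dotN (l : List ℕ) : List ℕ → ℕ :=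
  List.rec (fun _ => 0) (fun x _ ih ys => List.rec 0 (fun y ys' _ => Nat.add (Nat.mul x y) (ih ys')) ys) l

def invOK (p n : ℕ) (A B : List (List ℕ)) : Bool :=
  (List.range n).all fun i => (List.range n).all fun j =>
    Nat.beq (Nat.mod (dotN (A.getD i []) (B.getD j [])) p) (if i = j then 1 else 0)

def matOK (p : ℕ) (ext : List Z3) (rows : List Q4) (B : List (List ℕ)) : Bool :=
  Nat.beq rows.length ext.length &&
  forceLL (rows.map fun t => ext.map fun e => modN p (rowVal t e)) fun A => invOK p ext.length A B

def mon (a b c : ℕ) : Fin 3 →₀ ℕ := Finsupp.single 0 a + Finsupp.single 1 b + Finsupp.single 2 c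

theorem mon0 (a b c : ℕ) : mon a b c 0 = a := by simp [mon]
theorem mon1 (a b c : ℕ) : mon a b c 1 = b := by simp [mon]
theorem mon2 (a b c : ℕ) : mon a b c 2 = c := by simp [mon]
theorem mon_eta (m : Fin 3 →₀ ℕ) : m = mon (m 0) (m 1) (m 2) := by
  ext i; fin_cases i <;> simp [mon]
theorem mon_add (a b c i j k : ℕ) : mon a b c + mon i j k = mon (a + i) (b + j) (c + k) := by
  ext x; fin_cases x <;> simp [mon]
theorem mon_deg (a b c : ℕ) : (mon a b c).degree = a + b + c := by
  simp [mon, map_add]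

def ell : PolyQ →ₗ[ℚ] ℚ :=
  (basisMonomials (Fin 3) ℚ).constr ℚ
    (fun m => if m 0 + m 1 + m 2 = 33 then (wf (m 0) (m 1) : ℚ) else 0)

theorem ell_mon (a b c : ℕ) (x : ℚ) : ell (monomial (mon a b c) x) =
    x * (if a + b + c = 33 then (wf a b : ℚ) else 0) := by
  have h : (monomial (mon a b c) x : PolyQ) = x • basisMonomials (Fin 3) ℚ (mon a b c) := by
    rw [coe_basisMonomials, smul_monomial, smul_eq_mul, mul_one]
  rw [h, map_smul, ell, Module.Basis.constr_basis, mon0, mon1, mon2, smul_eq_mul]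

def toP (l : List Q4) : PolyQ :=
  (l.map fun t => monomial (mon t.2.1 t.2.2.1 t.2.2.2) (t.1 : ℚ)).sum

theorem toP_cons (t : Q4) (l : List Q4) :
    toP (t :: l) = monomial (mon t.2.1 t.2.2.1 t.2.2.2) (t.1 : ℚ) + toP l := by simp [toP]

def gP (g : List Q4 × List Q4) : PolyQ := toP g.1 - toP g.2

def degOK (d : ℕ) (l : List Q4) : Bool := l.all fun t => Nat.beq (t.2.1 + t.2.2.1 + t.2.2.2) d

theorem degOK_cons {d : ℕ} {t : Q4} {l : List Q4} (h : degOK d (t :: l) = true) :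
    t.2.1 + t.2.2.1 + t.2.2.2 = d ∧ degOK d l = true := by
  simpa [degOK] using h

theorem toP_hom {d : ℕ} {l : List Q4} (h : degOK d l = true) : (toP l).IsHomogeneous d := by
  induction l with
  | nil => simpa [toP] using isHomogeneous_zero (Fin 3) ℚ d
  | cons t l ih =>
    obtain ⟨h1, h2⟩ := degOK_cons h
    rw [toP_cons]
    exact (isHomogeneous_monomial _ (by rw [mon_deg, h1])).add (ih h2)

theorem ell_toP {d : ℕ} {l : List Q4} (h : degOK d l = true) (i j k : ℕ) (hd : d + (i + j + k) = 33) :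
    ell (toP l * monomial (mon i j k) 1) = (ellN l i j : ℚ) - (ellS l i j : ℚ) := by
  induction l with
  | nil => simp [toP, ellN, ellS]
  | cons t l ih =>
    obtain ⟨h1, h2⟩ := degOK_cons h
    have e1 : ellN (t :: l) i j = t.1 * wdig (t.2.1 + i) (t.2.2.1 + j) + ellN l i j := rfl
    have e2 : ellS (t :: l) i j = t.1 * wdig (t.2.2.1 + j) (t.2.1 + i) + ellS l i j := rfl
    rw [toP_cons, add_mul, map_add, ih h2, monomial_mul, mon_add, ell_mon, if_pos (by omega), e1, e2, wf]
    push_cast; ring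

def cpt (su sv : ℕ) (p : ℕ × ℕ × ℕ) : Fin 3 → ℚ :=
  ![(-1) ^ su * (p.1 : ℚ), (-1) ^ sv * (p.2.1 : ℚ), (p.2.2 : ℚ)]

def evL (x : Fin 3 → ℚ) : PolyQ →ₗ[ℚ] ℚ := (aeval x : PolyQ →ₐ[ℚ] ℚ).toLinearMap

theorem evL_apply (x : Fin 3 → ℚ) (f : PolyQ) : evL x f = eval x f := by
  simp [evL]

theorem eval_mon (x : Fin 3 → ℚ) (a b c : ℕ) (r : ℚ) :
    eval x (monomial (mon a b c) r) = r * (x 0 ^ a * x 1 ^ b * x 2 ^ c) := by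
  rw [eval_monomial, Finsupp.prod_fintype _ _ (by simp), Fin.prod_univ_three, mon0, mon1, mon2]

theorem cls_one (su sv : ℕ) (cs : List ℤ) : ∀ ps : List (ℕ × ℕ × ℕ),
    ∃ Φ : PolyQ →ₗ[ℚ] ℚ, (∀ i j k, Φ (monomial (mon i j k) 1) =
      (-1) ^ (su * i + sv * j) * ((posN i j k cs ps : ℚ) - (negN i j k cs ps : ℚ))) ∧
      ∀ h, (∀ p ∈ ps, eval (cpt su sv p) h = 0) → Φ h = 0 := by
  induction cs with
  | nil => intro ps; exact ⟨0, by simp [posN, negN], by simp⟩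
  | cons c cs ih =>
    intro ps
    rcases ps with _ | ⟨p, ps⟩
    · exact ⟨0, by simp [posN, negN], by simp⟩
    · obtain ⟨Φ, h1, h2⟩ := ih ps
      refine ⟨(c : ℚ) • evL (cpt su sv p) + Φ, ?_, ?_⟩
      · intro i j k
        have hm : (magN p i j k : ℚ) = (p.1 : ℚ) ^ i * ((p.2.1 : ℚ) ^ j * (p.2.2 : ℚ) ^ k) := by
          have : magN p i j k = p.1 ^ i * (p.2.1 ^ j * p.2.2 ^ k) := rfl
          rw [this]; push_cast; ring
        have hv : eval (cpt su sv p) (monomial (mon i j k) 1) =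
            (-1) ^ (su * i + sv * j) * (magN p i j k : ℚ) := by
          rw [eval_mon, hm]
          simp only [cpt, Matrix.cons_val_zero, Matrix.cons_val_one, Matrix.cons_val]
          rw [mul_pow, mul_pow, pow_add, pow_mul, pow_mul]; ring
        rw [LinearMap.add_apply, LinearMap.smul_apply, h1, evL_apply, hv, smul_eq_mul]
        rcases c with m | m
        · have e1 : posN i j k (Int.ofNat m :: cs) (p :: ps) =
            m * magN p i j k + posN i j k cs ps := rfl
          have e2 : negN i j k (Int.ofNat m :: cs) (p :: ps) = negN i j k cs ps := rfl
          rw [e1, e2]; push_cast; simp; ring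
        · have e1 : posN i j k (Int.negSucc m :: cs) (p :: ps) = posN i j k cs ps := rfl
          have e2 : negN i j k (Int.negSucc m :: cs) (p :: ps) =
            (m + 1) * magN p i j k + negN i j k cs ps := rfl
          rw [e1, e2, Int.cast_negSucc]; push_cast; ring
      · intro h hh
        rw [LinearMap.add_apply, LinearMap.smul_apply, evL_apply, hh p List.mem_cons_self,
          h2 h (fun p hp => hh p (List.mem_cons_of_mem _ hp)), smul_zero, add_zero]

theorem cls_all (cc : List (List ℤ)) : ∀ L : List (ℕ × ℕ × List (ℕ × ℕ × ℕ)),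
    ∃ Φ : PolyQ →ₗ[ℚ] ℚ, (∀ i j k, Φ (monomial (mon i j k) 1) = (clsSum i j k cc L : ℚ)) ∧
      ∀ h, (∀ s ∈ L, ∀ p ∈ s.2.2, eval (cpt s.1 s.2.1 p) h = 0) → Φ h = 0 := by
  induction cc with
  | nil => intro L; exact ⟨0, by simp [clsSum], by simp⟩
  | cons c cc ih =>
    intro L
    rcases L with _ | ⟨s, L⟩
    · exact ⟨0, by simp [clsSum], by simp⟩
    · obtain ⟨Φ, h1, h2⟩ := ih L
      obtain ⟨Ψ, h3, h4⟩ := cls_one s.1 s.2.1 c s.2.2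
      refine ⟨Ψ + Φ, ?_, ?_⟩
      · intro i j k
        rw [LinearMap.add_apply, h1, h3, clsSum]; push_cast; ring
      · intro h hh
        rw [LinearMap.add_apply, h4 h (hh s List.mem_cons_self),
          h2 h (fun s hs => hh s (List.mem_cons_of_mem _ hs)), add_zero]

def czp (su sv : ℕ) (p : ℕ × ℕ × ℕ) : Z3 := ((-1) ^ su * (p.1 : ℤ), (-1) ^ sv * (p.2.1 : ℤ), (p.2.2 : ℤ))

theorem czp_pt (su sv : ℕ) (p : ℕ × ℕ × ℕ) : pt (czp su sv p) = cpt su sv p := by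
  simp [pt, czp, cpt]

theorem cls_pts : (pcls.all fun s => s.2.2.all fun p => ptsZ.elem (czp s.1 s.2.1 p)) = true := by
  decide +kernel

theorem cls_van {h : PolyQ} (h0 : ∀ q ∈ ptsZ, eval (pt q) h = 0) :
    ∀ s ∈ pcls, ∀ p ∈ s.2.2, eval (cpt s.1 s.2.1 p) h = 0 := by
  intro s hs p hp
  have h1 := cls_pts
  rw [List.all_eq_true] at h1
  have h2 := h1 s hs
  rw [List.all_eq_true] at h2
  have h3 := h2 p hp
  rw [← czp_pt]
  exact h0 _ (by simpa using h3)

theorem hom_ext {Φ Ψ : PolyQ →ₗ[ℚ] ℚ} {n : ℕ} (hm : ∀ i j k, i + j + k = n →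
    Φ (monomial (mon i j k) 1) = Ψ (monomial (mon i j k) 1)) {h : PolyQ} (hh : h.IsHomogeneous n) :
    Φ h = Ψ h := by
  rw [h.as_sum, map_sum, map_sum]
  refine Finset.sum_congr rfl fun m hmm => ?_
  have h1 : m.degree = n := by
    by_contra h
    exact (mem_support_iff.mp hmm) (hh.coeff_eq_zero h)
  have h2 : (monomial m (coeff m h) : PolyQ) = coeff m h • monomial (mon (m 0) (m 1) (m 2)) 1 := by
    rw [smul_monomial, smul_eq_mul, mul_one, ← mon_eta]
  rw [h2, map_smul, map_smul, hm]
  rw [mon_eta m, mon_deg] at h1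
  exact h1

theorem cert_spec {gp gn : List Q4} {D : ℕ} {cc : List (List ℤ)} {n d : ℕ} (hd : d + n = 33)
    (hD : D ≠ 0) (h1 : degOK d gp = true) (h2 : degOK d gn = true) (hc : cert gp gn D cc n = true)
    {h : PolyQ} (hh : h.IsHomogeneous n) (h0 : ∀ q ∈ ptsZ, eval (pt q) h = 0) :
    ell (gP (gp, gn) * h) = 0 := by
  obtain ⟨Φ, hΦ, hΦ0⟩ := cls_all cc pcls
  have key : ((D : ℚ) • (ell ∘ₗ LinearMap.mulLeft ℚ (gP (gp, gn)))) h = Φ h := by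
    refine hom_ext (n := n) ?_ hh
    intro i j k hijk
    rw [hΦ, LinearMap.smul_apply, LinearMap.comp_apply, LinearMap.mulLeft_apply, gP, sub_mul, map_sub,
      ell_toP h1 i j k (by omega), ell_toP h2 i j k (by omega)]
    rw [cert, List.all_eq_true] at hc
    have h3 := hc i (List.mem_range.mpr (by omega))
    rw [List.all_eq_true] at h3
    have h4 := h3 j (List.mem_range.mpr (by omega))
    rw [beq_iff_eq, show n - i - j = k by omega] at h4
    rw [← h4, smul_eq_mul]; push_cast; ring
  rw [hΦ0 h (cls_van h0), LinearMap.smul_apply, LinearMap.comp_apply, LinearMap.mulLeft_apply,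
    smul_eq_mul] at key
  exact (mul_eq_zero.mp key).resolve_left (by exact_mod_cast hD)

theorem sgn_abs (x : ℤ) : (x : ℚ) = (-1) ^ sgnN x * (absN x : ℚ) := by
  rcases x with m | m
  · simp [sgnN, absN]
  · have : absN (Int.negSucc m) = m + 1 := rfl
    rw [this]
    simp [sgnN, Int.cast_negSucc]

theorem evA_spec (su sv sz u v z : ℕ) (l : List Q4) :
    eval ![(-1) ^ su * (u : ℚ), (-1) ^ sv * (v : ℚ), (-1) ^ sz * (z : ℚ)] (toP l) =
      (evA 0 su sv sz u v z l : ℚ) - (evA 1 su sv sz u v z l : ℚ) := by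
  induction l with
  | nil => simp [toP, evA]
  | cons t l ih =>
    rw [toP_cons, map_add, ih, eval_mon]
    simp only [Matrix.cons_val_zero, Matrix.cons_val_one, Matrix.cons_val]
    have hm : (magN (u, v, z) t.2.1 t.2.2.1 t.2.2.2 : ℚ) =
        (u : ℚ) ^ t.2.1 * ((v : ℚ) ^ t.2.2.1 * (z : ℚ) ^ t.2.2.2) := by
      have : magN (u, v, z) t.2.1 t.2.2.1 t.2.2.2 = u ^ t.2.1 * (v ^ t.2.2.1 * z ^ t.2.2.2) := rfl
      rw [this]; push_cast; ring
    have e : ∀ r, evA r su sv sz u v z (t :: l) = Nat.rec (motive := fun _ => ℕ)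
        (t.1 * magN (u, v, z) t.2.1 t.2.2.1 t.2.2.2 + evA r su sv sz u v z l)
        (fun _ _ => evA r su sv sz u v z l)
        ((r + (su * t.2.1 + (sv * t.2.2.1 + sz * t.2.2.2))) % 2) := fun r => rfl
    have hp : ((-1) ^ su * (u : ℚ)) ^ t.2.1 * ((-1) ^ sv * (v : ℚ)) ^ t.2.2.1 *
        ((-1) ^ sz * (z : ℚ)) ^ t.2.2.2 = (-1) ^ (su * t.2.1 + (sv * t.2.2.1 + sz * t.2.2.2)) *
        (magN (u, v, z) t.2.1 t.2.2.1 t.2.2.2 : ℚ) := by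
      rw [hm, mul_pow, mul_pow, mul_pow, pow_add, pow_add, pow_mul, pow_mul, pow_mul]; ring
    have e0 : ∀ r, (r + (su * t.2.1 + (sv * t.2.2.1 + sz * t.2.2.2))) % 2 = 0 →
        evA r su sv sz u v z (t :: l) =
          t.1 * magN (u, v, z) t.2.1 t.2.2.1 t.2.2.2 + evA r su sv sz u v z l := by
      intro r hr; rw [e, hr]; rfl
    have e1 : ∀ r, (r + (su * t.2.1 + (sv * t.2.2.1 + sz * t.2.2.2))) % 2 = 1 →
        evA r su sv sz u v z (t :: l) = evA r su sv sz u v z l := by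
      intro r hr; rw [e, hr]; rfl
    rw [hp]
    clear e
    set w := su * t.2.1 + (sv * t.2.2.1 + sz * t.2.2.2)
    rcases Nat.mod_two_eq_zero_or_one w with h | h
    · rw [e0 0 (by omega), e1 1 (by omega), Even.neg_one_pow (Nat.even_iff.mpr h)]
      push_cast; ring
    · rw [e1 0 (by omega), e0 1 (by omega), Odd.neg_one_pow (Nat.odd_iff.mpr h)]
      push_cast; ring

theorem evPN_spec (q : Z3) (l : List Q4) :
    eval (pt q) (toP l) = (evPN 0 q l : ℚ) - (evPN 1 q l : ℚ) := by
  rw [evPN, evPN, ← evA_spec, ← sgn_abs, ← sgn_abs, ← sgn_abs]; rfl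

theorem gP_eval (g : List Q4 × List Q4) (q : Z3) :
    eval (pt q) (gP g) = (evP g.1 g.2 q : ℚ) - (evM g.1 g.2 q : ℚ) := by
  have h1 : evP g.1 g.2 q = evPN 0 q g.1 + evPN 1 q g.2 := rfl
  have h2 : evM g.1 g.2 q = evPN 1 q g.1 + evPN 0 q g.2 := rfl
  rw [gP, map_sub, evPN_spec, evPN_spec, h1, h2]; push_cast; ring

theorem vanish_spec {g : List Q4 × List Q4} (h : vanish g = true) :
    ∀ q ∈ ptsZ, eval (pt q) (gP g) = 0 := by
  intro q hq
  rw [vanish, List.all_eq_true] at h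
  have := Nat.eq_of_beq_eq_true (h q hq)
  rw [gP_eval, this, sub_self]

theorem forceN_eq (x : ℕ) (k : ℕ → Bool) : forceN x k = k x := by cases x <;> rfl
theorem forceL_eq (l : List ℕ) : ∀ k, forceL l k = k l := by
  induction l with
  | nil => intro k; rfl
  | cons x l ih =>
    intro k
    have : forceL (x :: l) k = forceN x fun y => forceL l fun ys => k (y :: ys) := rfl
    rw [this, forceN_eq, ih]
theorem forceLL_eq (l : List (List ℕ)) : ∀ k, forceLL l k = k l := by
  induction l with
  | nil => intro k; rfl
  | cons x l ih =>
    intro k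
    have : forceLL (x :: l) k = forceL x fun y => forceLL l fun ys => k (y :: ys) := rfl
    rw [this, forceL_eq, ih]

theorem modN_cast (p : ℕ) (hp : p ≠ 0) (x : ℤ) : ((modN p x : ℕ) : ZMod p) = (x : ZMod p) := by
  have h : ((modN p x : ℕ) : ℤ) = x % (p : ℤ) :=
    Int.toNat_of_nonneg (Int.emod_nonneg _ (by exact_mod_cast hp))
  have h2 : ((modN p x : ℕ) : ZMod p) = (((modN p x : ℕ) : ℤ) : ZMod p) := by simp
  rw [h2, h, ZMod.intCast_mod]

theorem dotN_spec (l : List ℕ) : ∀ (m : List ℕ) (n : ℕ), l.length ≤ n →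
    dotN l m = ∑ j : Fin n, l.getD j 0 * m.getD j 0 := by
  induction l with
  | nil => intro m n _; simp [dotN]
  | cons x l ih =>
    intro m n hn
    rcases m with _ | ⟨y, m⟩
    · simp [dotN]
    · obtain ⟨n, rfl⟩ : ∃ k, n = k + 1 := ⟨n - 1, by simp at hn; omega⟩
      have e : dotN (x :: l) (y :: m) = x * y + dotN l m := rfl
      rw [e, ih m n (by simpa using hn), Fin.sum_univ_succ]
      simp

def rowP (t : Q4) : PolyQ := monomial (mon t.2.1 t.2.2.1 t.2.2.2) 1 * gP (gensZ.getD t.1 ([], []))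

theorem rowP_eval (t : Q4) (e : Z3) : eval (pt e) (rowP t) = (rowVal t e : ℚ) := by
  rw [rowP, map_mul, eval_mon, gP_eval, rowVal, Int.subNatNat_eq_coe]
  simp [pt]

theorem mat_spec {p : ℕ} {ext : List Z3} {rows : List Q4} {B : List (List ℕ)} (hp : 1 < p)
    (h : matOK p ext rows B = true) (g : PolyQ) :
    ∃ c : Fin ext.length → ℚ, ∀ e ∈ ext,
      eval (pt e) (∑ i, c i • rowP (rows.getD i (0, 0, 0, 0))) = eval (pt e) g := by
  rw [matOK, forceLL_eq, Bool.and_eq_true] at h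
  obtain ⟨h1, h2⟩ := h
  have hlen := Nat.eq_of_beq_eq_true h1
  set n := ext.length with hn
  let A : Matrix (Fin n) (Fin n) ℤ := fun i j =>
    rowVal (rows.getD i (0, 0, 0, 0)) (ext.get j)
  let Bm : Matrix (Fin n) (Fin n) (ZMod p) := fun i j => (((B.getD j []).getD i 0 : ℕ) : ZMod p)
  have hAB : (A.map (Int.castRingHom (ZMod p))) * Bm = 1 := by
    ext i j
    rw [invOK, List.all_eq_true] at h2
    have h3 := h2 i (List.mem_range.mpr i.2)
    rw [List.all_eq_true] at h3
    have h4 := Nat.eq_of_beq_eq_true (h3 j (List.mem_range.mpr j.2))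
    have h5 : (rows.map fun t => ext.map fun e => modN p (rowVal t e)).getD i [] =
        ext.map fun e => modN p (rowVal (rows.getD i (0, 0, 0, 0)) e) := by
      have hi : (i : ℕ) < rows.length := by rw [hlen]; exact i.2
      simp [List.getD_eq_getElem?_getD, hi]
    rw [h5, dotN_spec _ _ n (by simp [hn])] at h4
    have h6 := congrArg (fun x : ℕ => (x : ZMod p)) h4
    beta_reduce at h6
    have h7 : ∀ x : ℕ, ((Nat.mod x p : ℕ) : ZMod p) = (x : ZMod p) := fun x => ZMod.natCast_mod x p
    rw [h7] at h6
    rw [Matrix.mul_apply, Matrix.one_apply]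
    push_cast at h6
    rw [show (if i = j then (1 : ZMod p) else 0) = if (i : ℕ) = j then 1 else 0 by
      simp [Fin.ext_iff]]
    rw [← h6]
    refine Finset.sum_congr rfl fun k _ => ?_
    have h8 : (ext.map fun e => modN p (rowVal (rows.getD i (0, 0, 0, 0)) e)).getD k 0 =
        modN p (A i k) := by
      have hk : (k : ℕ) < ext.length := k.2
      simp [List.getD_eq_getElem?_getD, hk, A]
    rw [h8, modN_cast p (by omega)]
    simp [Bm]
  have hdet : A.det ≠ 0 := by
    intro h0
    have h3 := congrArg Matrix.det hAB
    rw [Matrix.det_mul, Matrix.det_one, ← RingHom.mapMatrix_apply, ← RingHom.map_det, h0, map_zero,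
      zero_mul] at h3
    have : Fact (1 < p) := ⟨hp⟩
    exact zero_ne_one h3
  let AQ : Matrix (Fin n) (Fin n) ℚ := A.map (Int.castRingHom ℚ)
  have hdQ : IsUnit AQ.det := by
    rw [isUnit_iff_ne_zero, show AQ.det = (Int.castRingHom ℚ) A.det by
      rw [RingHom.map_det]; rfl]
    simpa using hdet
  let tv : Fin n → ℚ := fun j => eval (pt (ext.get j)) g
  refine ⟨Matrix.vecMul tv AQ⁻¹, ?_⟩
  intro e he
  obtain ⟨j, rfl⟩ := List.get_of_mem he
  have h3 : Matrix.vecMul (Matrix.vecMul tv AQ⁻¹) AQ = tv := by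
    rw [Matrix.vecMul_vecMul, Matrix.nonsing_inv_mul _ hdQ, Matrix.vecMul_one]
  have h4 := congrFun h3 j
  rw [map_sum]
  simp only [smul_eval, rowP_eval]
  exact h4

/-- forms of degree `d` in the ideal that are orthogonal to the ideal -/
def good (d : ℕ) : Submodule ℚ PolyQ where
  carrier := {f | f.IsHomogeneous d ∧ (∀ q ∈ ptsZ, eval (pt q) f = 0) ∧
    ∀ h : PolyQ, h.IsHomogeneous (33 - d) → (∀ q ∈ ptsZ, eval (pt q) h = 0) → ell (f * h) = 0}
  zero_mem' := ⟨isHomogeneous_zero _ _ _, by simp, by simp⟩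
  add_mem' := by
    rintro a b ⟨a1, a2, a3⟩ ⟨b1, b2, b3⟩
    refine ⟨a1.add b1, fun q hq => by rw [map_add, a2 q hq, b2 q hq, add_zero], fun h h1 h2 => ?_⟩
    rw [add_mul, map_add, a3 h h1 h2, b3 h h1 h2, add_zero]
  smul_mem' := by
    rintro c a ⟨a1, a2, a3⟩
    refine ⟨(homogeneousSubmodule (Fin 3) ℚ d).smul_mem c a1,
      fun q hq => by rw [smul_eval, a2 q hq, mul_zero], fun h h1 h2 => ?_⟩
    rw [smul_mul_assoc, map_smul, a3 h h1 h2, smul_zero]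

theorem good_mul {d i j k : ℕ} {f : PolyQ} (hf : f ∈ good d) (hd : i + j + k + d ≤ 33) :
    monomial (mon i j k) 1 * f ∈ good (i + j + k + d) := by
  obtain ⟨h1, h2, h3⟩ := hf
  have hm : (monomial (mon i j k) 1 : PolyQ).IsHomogeneous (i + j + k) :=
    isHomogeneous_monomial _ (mon_deg i j k)
  refine ⟨hm.mul h1, fun q hq => by rw [map_mul, h2 q hq, mul_zero], fun h h4 h5 => ?_⟩
  rw [mul_comm (monomial _ _) f, mul_assoc]
  refine h3 _ ?_ fun q hq => by rw [map_mul, h5 q hq, mul_zero]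
  have := hm.mul h4
  rwa [show i + j + k + (33 - (i + j + k + d)) = 33 - d by omega] at this

theorem good_gen {gp gn : List Q4} {D : ℕ} {cc : List (List ℤ)} {d : ℕ} (hd : d ≤ 33) (hD : D ≠ 0)
    (h1 : degOK d gp = true) (h2 : degOK d gn = true) (hv : vanish (gp, gn) = true)
    (hc : cert gp gn D cc (33 - d) = true) : gP (gp, gn) ∈ good d :=
  ⟨(toP_hom h1).sub (toP_hom h2), vanish_spec hv,
    fun _ hh h0 => cert_spec (by omega) hD h1 h2 hc hh h0⟩

theorem good0 : gP (gp0, gn0) ∈ good 14 := good_gen (D := 310464000) (cc := cc0) (by decide)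
  (by decide) (by decide +kernel) (by decide +kernel) (by decide +kernel) (by decide +kernel)
theorem good1 : gP (gp1, gn1) ∈ good 14 := good_gen (D := 310464000) (cc := cc1) (by decide)
  (by decide) (by decide +kernel) (by decide +kernel) (by decide +kernel) (by decide +kernel)
theorem good2 : gP (gp2, gn2) ∈ good 14 := good_gen (D := 232848000) (cc := cc2) (by decide)
  (by decide) (by decide +kernel) (by decide +kernel) (by decide +kernel) (by decide +kernel)
theorem good3 : gP (gp3, gn3) ∈ good 15 := good_gen (D := 2897664000) (cc := cc3) (by decide)
  (by decide) (by decide +kernel) (by decide +kernel) (by decide +kernel) (by decide +kernel)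
theorem good4 : gP (gp4, gn4) ∈ good 15 := good_gen (D := 2173248000) (cc := cc4) (by decide)
  (by decide) (by decide +kernel) (by decide +kernel) (by decide +kernel) (by decide +kernel)
theorem good5 : gP (gp5, gn5) ∈ good 15 := good_gen (D := 543312000) (cc := cc5) (by decide)
  (by decide) (by decide +kernel) (by decide +kernel) (by decide +kernel) (by decide +kernel)
theorem good6 : gP (gp6, gn6) ∈ good 15 := good_gen (D := 543312000) (cc := cc6) (by decide)
  (by decide) (by decide +kernel) (by decide +kernel) (by decide +kernel) (by decide +kernel)

def gdeg (i : ℕ) : ℕ := if i < 3 then 14 else 15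

theorem good_gens (i : ℕ) : gP (gensZ.getD i ([], [])) ∈ good (gdeg i) := by
  rcases i with _ | _ | _ | _ | _ | _ | _ | i
  · exact good0
  · exact good1
  · exact good2
  · exact good3
  · exact good4
  · exact good5
  · exact good6
  · have : gP (gensZ.getD (i + 1 + 1 + 1 + 1 + 1 + 1 + 1) ([], [])) = 0 := by
      simp [gensZ, gP, toP]
    rw [this]; exact Submodule.zero_mem _

def rowsOK (d : ℕ) (rows : List Q4) : Bool :=
  rows.all fun t => Nat.beq (t.2.1 + t.2.2.1 + t.2.2.2 + gdeg t.1) d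

theorem span_spec {p d : ℕ} {ext : List Z3} {rows : List Q4} {B : List (List ℕ)}
    {st : List (Z3 × Z3)} (hp : 1 < p) (hd : d ≤ 33)
    (hr : rowsOK d rows = true) (hpe : peel d (ext ++ ptsZ) st = true)
    (h : matOK p ext rows B = true) (g : PolyQ) (hg : g.IsHomogeneous d)
    (h0 : ∀ q ∈ ptsZ, eval (pt q) g = 0) : g ∈ good d := by
  obtain ⟨c, hc⟩ := mat_spec hp h g
  have hlen : rows.length = ext.length := by
    rw [matOK, Bool.and_eq_true] at h
    exact Nat.eq_of_beq_eq_true h.1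
  have hf : (∑ i, c i • rowP (rows.getD i (0, 0, 0, 0))) ∈ good d := by
    refine Submodule.sum_mem _ fun i _ => Submodule.smul_mem _ _ ?_
    have hi : (i : ℕ) < rows.length := by rw [hlen]; exact i.2
    have hm : rows.getD i (0, 0, 0, 0) ∈ rows := by
      rw [List.getD_eq_getElem _ _ hi]; exact List.getElem_mem hi
    rw [rowsOK, List.all_eq_true] at hr
    have h1 := Nat.eq_of_beq_eq_true (hr _ hm)
    have h2 := good_mul (i := (rows.getD i (0, 0, 0, 0)).2.1) (j := (rows.getD i (0, 0, 0, 0)).2.2.1)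
      (k := (rows.getD i (0, 0, 0, 0)).2.2.2) (good_gens (rows.getD i (0, 0, 0, 0)).1) (by omega)
    rw [h1] at h2
    exact h2
  have hz : g - ∑ i, c i • rowP (rows.getD i (0, 0, 0, 0)) = 0 := by
    refine peel_spec d _ st _ hpe (hg.sub hf.1) ?_
    intro q hq
    rw [map_sub]
    rcases List.mem_append.mp hq with h1 | h1
    · rw [hc q h1, sub_self]
    · rw [h0 q h1, hf.2.1 q h1, sub_self]
  rw [sub_eq_zero.mp hz]
  exact hf

theorem good14 {g : PolyQ} (hg : g.IsHomogeneous 14) (h0 : ∀ q ∈ ptsZ, eval (pt q) g = 0) :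
    g ∈ good 14 :=
  span_spec (p := prm14) (ext := ext14) (rows := rows14) (B := inv14) (st := steps14)
    (by decide) (by decide) (by decide +kernel) (by decide +kernel) (by decide +kernel) g hg h0
theorem good15 {g : PolyQ} (hg : g.IsHomogeneous 15) (h0 : ∀ q ∈ ptsZ, eval (pt q) g = 0) :
    g ∈ good 15 :=
  span_spec (p := prm15) (ext := ext15) (rows := rows15) (B := inv15) (st := steps15)
    (by decide) (by decide) (by decide +kernel) (by decide +kernel) (by decide +kernel) g hg h0
theorem good16 {g : PolyQ} (hg : g.IsHomogeneous 16) (h0 : ∀ q ∈ ptsZ, eval (pt q) g = 0) :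
    g ∈ good 16 :=
  span_spec (p := prm16) (ext := ext16) (rows := rows16) (B := inv16) (st := steps16)
    (by decide) (by decide) (by decide +kernel) (by decide +kernel) (by decide +kernel) g hg h0

/-- in degrees up to 13 the ideal vanishes -/
theorem zero13 {g : PolyQ} {d : ℕ} (hd : d ≤ 13) (hg : g.IsHomogeneous d)
    (h0 : ∀ q ∈ ptsZ, eval (pt q) g = 0) : g = 0 := by
  have h1 : X 0 ^ (13 - d) * g = 0 := by
    refine peel_spec 13 ptsZ steps13 _ (by decide +kernel) ?_ fun q hq => by
      rw [map_mul, h0 q hq, mul_zero]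
    have := ((isHomogeneous_X ℚ (0 : Fin 3)).pow (13 - d)).mul hg
    rwa [show 1 * (13 - d) + d = 13 by omega] at this
  exact (mul_eq_zero.mp h1).resolve_left (pow_ne_zero _ (X_ne_zero _))

theorem ell_half {f h : PolyQ} {a b : ℕ} (hab : a + b = 33) (ha : a ≤ 16) (hf : f.IsHomogeneous a)
    (hh : h.IsHomogeneous b) (hf0 : ∀ q ∈ ptsZ, eval (pt q) f = 0)
    (hh0 : ∀ q ∈ ptsZ, eval (pt q) h = 0) : ell (f * h) = 0 := by
  rw [show b = 33 - a by omega] at hh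
  by_cases h13 : a ≤ 13
  · rw [zero13 h13 hf hf0, zero_mul, map_zero]
  · have : f ∈ good a := by
      obtain rfl | rfl | rfl : a = 14 ∨ a = 15 ∨ a = 16 := by omega
      · exact good14 hf hf0
      · exact good15 hf hf0
      · exact good16 hf hf0
    exact this.2.2 h hh hh0

theorem ell_hom0 {f : PolyQ} {n : ℕ} (hn : n ≠ 33) (hf : f.IsHomogeneous n) : ell f = 0 := by
  have := hom_ext (Φ := ell) (Ψ := 0) (n := n) (fun i j k hijk => by
    rw [ell_mon, if_neg (by omega)]; simp) hf
  simpa using this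

theorem ell_mul_hom {f h : PolyQ} {a b : ℕ} (hf : f.IsHomogeneous a)
    (hh : h.IsHomogeneous b) (hf0 : ∀ q ∈ ptsZ, eval (pt q) f = 0)
    (hh0 : ∀ q ∈ ptsZ, eval (pt q) h = 0) : ell (f * h) = 0 := by
  by_cases hab : a + b = 33
  · by_cases ha : a ≤ 16
    · exact ell_half hab ha hf hh hf0 hh0
    · rw [mul_comm]
      exact ell_half (by omega) (by omega) hh hf hh0 hf0
  · exact ell_hom0 hab (hf.mul hh)

def lnZ : Fin 31 → Z3 :=
  ![(1, 0, -4), (1, 0, -2), (1, 0, -1), (1, 0, 0), (1, 0, 1), (1, 0, 2), (1, 0, 4),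
    (0, 1, -4), (0, 1, -2), (0, 1, -1), (0, 1, 0), (0, 1, 1), (0, 1, 2), (0, 1, 4),
    (1, 1, -4), (1, 1, -2), (1, 1, -1), (1, 1, 0), (1, 1, 1), (1, 1, 2), (1, 1, 4),
    (-1, 1, -2), (-1, 1, 0), (-1, 1, 2), (2, 1, -2), (2, 1, 0), (2, 1, 2),
    (1, 2, -2), (1, 2, 0), (1, 2, 2), (0, 0, 1)]

def Mx (x : Fin 3 → ℚ) : Fin 3 → ℚ := ![(x 0 + x 1) / 3 - 4 * x 2, (2 * x 0 - x 1) / 3, x 2]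
def Nx (x : Fin 3 → ℚ) : Fin 3 → ℚ := ![x 0 + x 1 + 4 * x 2, 2 * x 0 - x 1 + 8 * x 2, x 2]

theorem Mx_Nx (x : Fin 3 → ℚ) : Mx (Nx x) = x := by
  funext i; fin_cases i <;> simp [Mx, Nx] <;> ring
theorem Nx_Mx (x : Fin 3 → ℚ) : Nx (Mx x) = x := by
  funext i; fin_cases i <;> simp [Mx, Nx] <;> ring
theorem Mx_smul (c : ℚ) (x : Fin 3 → ℚ) : Mx (c • x) = c • Mx x := by
  funext i; fin_cases i <;> simp [Mx] <;> ring
theorem Nx_smul (c : ℚ) (x : Fin 3 → ℚ) : Nx (c • x) = c • Nx x := by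
  funext i; fin_cases i <;> simp [Nx] <;> ring

theorem line_eval (i : Fin 31) (x : Fin 3 → ℚ) :
    eval x (linesQ i) = dt (pt (lnZ i)) (Nx x) := by
  fin_cases i <;> simp [linesQ, lnZ, dt, pt, Nx] <;> ring

def sg : PolyQ →ₐ[ℚ] PolyQ :=
  aeval ![C (1 / 3) * (X 0 + X 1) - C 4 * X 2, C (1 / 3) * (C 2 * X 0 - X 1), X 2]
def ta : PolyQ →ₐ[ℚ] PolyQ :=
  aeval ![X 0 + X 1 + C 4 * X 2, C 2 * X 0 - X 1 + C 8 * X 2, X 2]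

theorem eval_aev (x : Fin 3 → ℚ) (φ : Fin 3 → PolyQ) (f : PolyQ) :
    eval x (aeval φ f) = eval (fun i => eval x (φ i)) f := by
  induction f using MvPolynomial.induction_on with
  | C a => simp
  | add a b ha hb => rw [map_add, map_add, map_add, ha, hb]
  | mul_X a i ha => rw [map_mul, map_mul, map_mul, ha, aeval_X, eval_X]

theorem eval_sg (x : Fin 3 → ℚ) (f : PolyQ) : eval x (sg f) = eval (Mx x) f := by
  rw [sg, eval_aev]
  congr 2
  funext i
  fin_cases i <;> simp [Mx] <;> ring
theorem eval_ta (x : Fin 3 → ℚ) (f : PolyQ) : eval x (ta f) = eval (Nx x) f := by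
  rw [ta, eval_aev]
  congr 2
  funext i
  fin_cases i <;> simp [Nx]

theorem sg_ta (f : PolyQ) : sg (ta f) = f := by
  apply MvPolynomial.funext; intro x
  rw [eval_sg, eval_ta, Nx_Mx]
theorem sg_line (i : Fin 31) : sg (linesQ i) = lf (pt (lnZ i)) := by
  apply MvPolynomial.funext; intro x
  rw [eval_sg, line_eval, Nx_Mx, eval_lf]

theorem pts_lines : (ptsZ.all fun q => (List.finRange 31).any fun i => (dtZ (lnZ i) q == 0) &&
    (List.finRange 31).any fun j => (i != j) && (dtZ (lnZ j) q == 0)) = true := by decide +kernel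

theorem pts_ne_s9 : (ptsZ.all fun q => q != (0, 0, 0)) = true := by decide +kernel

theorem pt_ne {q : Z3} (hq : q ∈ ptsZ) : pt q ≠ 0 := by
  have h := pts_ne_s9
  rw [List.all_eq_true] at h
  have h1 := h q hq
  intro h2
  have a0 := congrFun h2 0
  have a1 := congrFun h2 1
  have a2 := congrFun h2 2
  simp [pt] at a0 a1 a2
  have : q = (0, 0, 0) := by ext <;> simp [a0, a1, a2]
  simp [this] at h1

theorem dt_smul (n : Fin 3 → ℚ) (c : ℚ) (x : Fin 3 → ℚ) : dt n (c • x) = c * dt n x := by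
  simp [dt]; ring

/-- the intersection points, in the new coordinates -/
theorem pts_SQ {q : Z3} (hq : q ∈ ptsZ) : ∃ P ∈ SQ, ∃ c : ℚ, c ≠ 0 ∧
    Projectivization.rep P = c • Mx (pt q) := by
  have hne : Mx (pt q) ≠ 0 := by
    intro h
    have h1 := congrArg Nx h
    rw [Nx_Mx] at h1
    refine pt_ne hq (h1.trans ?_)
    funext i; fin_cases i <;> simp [Nx]
  obtain ⟨a, ha⟩ := Projectivization.exists_smul_eq_mk_rep ℚ (Mx (pt q)) hne
  have ha' : Projectivization.rep (Projectivization.mk ℚ (Mx (pt q)) hne) = (a : ℚ) • Mx (pt q) :=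
    ha.symm
  refine ⟨Projectivization.mk ℚ (Mx (pt q)) hne, ?_, a, a.ne_zero, ha'⟩
  have h := pts_lines
  rw [List.all_eq_true] at h
  have h1 := h q hq
  rw [List.any_eq_true] at h1
  obtain ⟨i, -, h1⟩ := h1
  rw [Bool.and_eq_true, List.any_eq_true] at h1
  obtain ⟨hi, j, -, h2⟩ := h1
  rw [Bool.and_eq_true] at h2
  have key : ∀ k : Fin 31, dtZ (lnZ k) q = 0 →
      eval (Projectivization.rep (Projectivization.mk ℚ (Mx (pt q)) hne)) (linesQ k) = 0 := by
    intro k hk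
    rw [line_eval, ha', Nx_smul, Nx_Mx, dt_smul, ← pt_dt, hk]; simp
  show 2 ≤ multQ _
  rw [multQ, Nat.succ_le_iff, Finset.one_lt_card]
  refine ⟨i, ?_, j, ?_, by simpa using h2.1⟩
  · simpa using key i (by simpa using hi)
  · simpa using key j (by simpa using h2.2)

theorem comp_van {g : PolyQ} {x : Fin 3 → ℚ} (h : ∀ c : ℚ, eval (c • x) g = 0) (d : ℕ) :
    eval x (homogeneousComponent d g) = 0 := by
  by_cases hd : d < g.totalDegree + 1
  · have hp : (∑ i ∈ Finset.range (g.totalDegree + 1),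
        Polynomial.C (eval x (homogeneousComponent i g)) * Polynomial.X ^ i : Polynomial ℚ) = 0 := by
      apply Polynomial.funext
      intro c
      have h1 := h c
      rw [← sum_homogeneousComponent g, map_sum] at h1
      rw [Polynomial.eval_finsetSum, Polynomial.eval_zero, ← h1]
      refine Finset.sum_congr rfl fun i _ => ?_
      rw [eval_hom (homogeneousComponent_isHomogeneous i g)]
      simp; ring
    have h2 := congrArg (fun p => Polynomial.coeff p d) hp
    simp only [Polynomial.finsetSum_coeff, Polynomial.coeff_C_mul_X_pow, Polynomial.coeff_zero] at h2
    rw [Finset.sum_ite_eq, if_pos (Finset.mem_range.mpr hd)] at h2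
    exact h2
  · rw [homogeneousComponent_eq_zero _ _ (by omega), map_zero]

def IQ : Ideal PolyQ := ⨅ P ∈ SQ, pointIdealQ (Projectivization.rep P)

theorem IQ_van {f : PolyQ} (hf : f ∈ IQ) (d : ℕ) :
    ∀ q ∈ ptsZ, eval (pt q) (homogeneousComponent d (sg f)) = 0 := by
  intro q hq
  apply comp_van
  intro c
  obtain ⟨P, hP, a, ha, hr⟩ := pts_SQ hq
  rw [eval_sg, Mx_smul]
  simp only [IQ, Submodule.mem_iInf] at hf
  have h1 : ∀ c : ℚ, eval (c • Projectivization.rep P) f = 0 := hf P hP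
  have h2 := h1 (c * a⁻¹)
  rwa [hr, smul_smul, mul_assoc, inv_mul_cancel₀ ha, mul_one] at h2

theorem ell_sq {f : PolyQ} (hf : f ∈ IQ ^ 2) : ell (sg f) = 0 := by
  rw [pow_two] at hf
  refine Submodule.mul_induction_on hf ?_ ?_
  · intro a ha b hb
    rw [map_mul, ← sum_homogeneousComponent (sg a), ← sum_homogeneousComponent (sg b),
      Finset.sum_mul, map_sum]
    refine Finset.sum_eq_zero fun i _ => ?_
    rw [Finset.mul_sum, map_sum]
    refine Finset.sum_eq_zero fun j _ => ?_
    exact ell_mul_hom (homogeneousComponent_isHomogeneous i _) (homogeneousComponent_isHomogeneous j _)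
      (IQ_van ha i) (IQ_van hb j)
  · intro a b ha hb
    rw [map_add, map_add, ha, hb, add_zero]

def idxF : List (Fin 31) :=
  [0, 2, 4, 6, 7, 9, 11, 13, 14, 16, 18, 20, 21, 22, 23, 24, 25, 26, 27, 28, 29]

def GP : PolyQ := gP (gGp, gGn)

def FQ : PolyQ := (idxF.map linesQ).prod * ta GP

def aZ (q : Z3) : ℤ := q.1 ^ 2 + q.1 * q.2.1 + q.2.1 ^ 2 - 7 * q.2.2 ^ 2
def bZ (q : Z3) : ℤ := (q.1 * q.2.1 * (q.1 + q.2.1)) ^ 2 - 36 * q.2.2 ^ 6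
def aP : PolyQ := X 0 ^ 2 + X 0 * X 1 + X 1 ^ 2 - C 7 * X 2 ^ 2
def bP : PolyQ := (X 0 * X 1 * (X 0 + X 1)) ^ 2 - C 36 * X 2 ^ 6

theorem mon_eq (a b c : ℕ) (r : ℚ) :
    (monomial (mon a b c) r : PolyQ) = C r * (X 0 ^ a * X 1 ^ b * X 2 ^ c) := by
  apply MvPolynomial.funext; intro x
  rw [eval_mon]; simp

set_option maxHeartbeats 4000000 in
theorem GP_eq : GP = aP ^ 2 * (C 6296904 * X 2 ^ 8 + C 1088784 * aP * X 2 ^ 6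
    - C 25808 * aP ^ 2 * X 2 ^ 4 - C 12872 * aP ^ 3 * X 2 ^ 2 - C 240 * aP ^ 4)
    + aP * bP * (- C 13998 * X 2 ^ 4 + C 46046 * aP * X 2 ^ 2 + C 3872 * aP ^ 2)
    - bP ^ 2 * C 11937 := by
  apply MvPolynomial.funext; intro x
  simp only [GP, gP, toP, gGp, gGn, List.map_cons, List.map_nil, List.sum_cons, List.sum_nil,
    map_sub, map_add, eval_mon, map_zero, map_mul, map_pow, eval_C, eval_X, aP, bP, map_neg]
  generalize x 0 = u
  generalize x 1 = v
  generalize x 2 = z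
  push_cast
  ring

def condOK (q : Z3) : Bool :=
  Nat.ble 3 (idxF.countP fun i => dtZ (lnZ i) q == 0) ||
  (Nat.ble 2 (idxF.countP fun i => dtZ (lnZ i) q == 0) && Nat.beq (evP gGp gGn q) (evM gGp gGn q)) ||
  (Nat.ble 1 (idxF.countP fun i => dtZ (lnZ i) q == 0) && (aZ q == 0 && bZ q == 0))

theorem cond_all : (ptsZ.all condOK) = true := by decide +kernel

def onLine (i : Fin 31) : List Z3 := ptsZ.filter fun q => dtZ (lnZ i) q == 0

def pairChk (i : Fin 31) (l : List Z3) : Bool :=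
  (List.finRange 31).all fun j => (i == j) ||
    ((crsZ (lnZ i) (lnZ j) != (0, 0, 0)) && l.any fun q => dtZ (lnZ j) q == 0)

theorem pairs_all : ((List.finRange 31).all fun i => pairChk i (onLine i)) = true := by decide +kernel

theorem perp {m n x : Fin 3 → ℚ} (hw : crs m n ≠ 0) (h1 : dt m x = 0) (h2 : dt n x = 0) :
    ∃ c : ℚ, x = c • crs m n := by
  have k0 : x 1 * crs m n 2 = x 2 * crs m n 1 := by
    simp [crs, dt] at *; linear_combination (-n 0) * h1 + m 0 * h2
  have k1 : x 2 * crs m n 0 = x 0 * crs m n 2 := by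
    simp [crs, dt] at *; linear_combination (-n 1) * h1 + m 1 * h2
  have k2 : x 0 * crs m n 1 = x 1 * crs m n 0 := by
    simp [crs, dt] at *; linear_combination (-n 2) * h1 + m 2 * h2
  generalize crs m n = w at *
  have : w 0 ≠ 0 ∨ w 1 ≠ 0 ∨ w 2 ≠ 0 := by
    by_contra! h
    exact hw (by funext i; fin_cases i; exacts [h.1, h.2.1, h.2.2])
  rcases this with h | h | h
  · refine ⟨x 0 / w 0, ?_⟩
    funext i; fin_cases i <;> simp <;> field_simp <;> linarith
  · refine ⟨x 1 / w 1, ?_⟩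
    funext i; fin_cases i <;> simp <;> field_simp <;> linarith
  · refine ⟨x 2 / w 2, ?_⟩
    funext i; fin_cases i <;> simp <;> field_simp <;> linarith

theorem SQ_pts {P : P2Q} (hP : P ∈ SQ) : ∃ q ∈ ptsZ, ∃ c : ℚ,
    Nx (Projectivization.rep P) = c • pt q := by
  have h : 2 ≤ multQ P := hP
  rw [multQ, Nat.succ_le_iff, Finset.one_lt_card] at h
  obtain ⟨i, hi, j, hj, hij⟩ := h
  simp only [Finset.mem_filter, Finset.mem_univ, true_and, line_eval] at hi hj
  have h1 := pairs_all
  rw [List.all_eq_true] at h1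
  have h2 := h1 i (List.mem_finRange i)
  rw [pairChk, List.all_eq_true] at h2
  have h3 := h2 j (List.mem_finRange j)
  rw [Bool.or_eq_true, Bool.and_eq_true, List.any_eq_true] at h3
  obtain ⟨h4, q, hq, hqj⟩ := h3.resolve_left (by simpa using hij)
  rw [onLine, List.mem_filter] at hq
  have hw : crs (pt (lnZ i)) (pt (lnZ j)) ≠ 0 := by
    rw [← pt_crs]
    intro h5
    generalize crsZ (lnZ i) (lnZ j) = w at *
    have a0 := congrFun h5 0
    have a1 := congrFun h5 1
    have a2 := congrFun h5 2
    simp [pt] at a0 a1 a2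
    have : w = (0, 0, 0) := by ext <;> simp [a0, a1, a2]
    simp [this] at h4
  have e1 : dt (pt (lnZ i)) (pt q) = 0 := by
    rw [← pt_dt, show dtZ (lnZ i) q = 0 by simpa using hq.2]; simp
  have e2 : dt (pt (lnZ j)) (pt q) = 0 := by
    rw [← pt_dt, show dtZ (lnZ j) q = 0 by simpa using hqj]; simp
  obtain ⟨a, ha⟩ := perp hw hi hj
  obtain ⟨b, hb⟩ := perp hw e1 e2
  have hb0 : b ≠ 0 := by
    rintro rfl
    exact pt_ne hq.1 (by rw [hb, zero_smul])
  refine ⟨q, hq.1, a * b⁻¹, ?_⟩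
  rw [ha, hb, smul_smul, mul_assoc, inv_mul_cancel₀ hb0, mul_one]

theorem prod_mem_pow (J : Ideal PolyQ) (p : Fin 31 → Bool) (hp : ∀ i, p i = true → linesQ i ∈ J)
    (l : List (Fin 31)) : (l.map linesQ).prod ∈ J ^ l.countP p := by
  induction l with
  | nil => simp
  | cons i l ih =>
    rw [List.map_cons, List.prod_cons]
    by_cases h : p i = true
    · rw [List.countP_cons_of_pos h, pow_succ']
      exact Ideal.mul_mem_mul (hp i h) ih
    · rw [List.countP_cons_of_neg h]
      exact Ideal.mul_mem_left _ _ ih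

theorem FQ_mem : FQ ∈ (⨅ P ∈ SQ, (pointIdealQ (Projectivization.rep P)) ^ 3 : Ideal PolyQ) := by
  simp only [Submodule.mem_iInf]
  intro P hP
  obtain ⟨q, hq, c, hc⟩ := SQ_pts hP
  set J := pointIdealQ (Projectivization.rep P) with hJ
  have hmem : ∀ {f : PolyQ} {d : ℕ}, f.IsHomogeneous d → eval (pt q) f = 0 → ta f ∈ J := by
    intro f d hf h0 e
    rw [eval_ta, Nx_smul, hc, smul_smul, eval_hom hf, h0, mul_zero]
  have hlin : ∀ i, (dtZ (lnZ i) q == 0) = true → linesQ i ∈ J := by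
    intro i hi e
    rw [line_eval, Nx_smul, hc, smul_smul, dt_smul, ← pt_dt, show dtZ (lnZ i) q = 0 by simpa using hi]
    simp
  have hprod := prod_mem_pow J (fun i => dtZ (lnZ i) q == 0) hlin idxF
  have hcond := cond_all
  rw [List.all_eq_true] at hcond
  have h1 := hcond q hq
  rw [condOK] at h1
  generalize idxF.countP (fun i => dtZ (lnZ i) q == 0) = r at *
  rw [Bool.or_eq_true, Bool.or_eq_true, Bool.and_eq_true, Bool.and_eq_true] at h1
  have hpw : ∀ s t : ℕ, s ≤ r → s + t = 3 → ta GP ∈ J ^ t → FQ ∈ J ^ 3 := by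
    intro s t hs hst ht
    have hJ3 : J ^ 3 = J ^ s * J ^ t := by rw [← pow_add, hst]
    rw [hJ3, FQ]
    exact Ideal.mul_mem_mul (Ideal.pow_le_pow_right hs hprod) ht
  rcases h1 with (h1 | ⟨h1, h2⟩) | ⟨h1, h2⟩
  · exact hpw 3 0 (Nat.le_of_ble_eq_true h1) rfl (by simp)
  · refine hpw 2 1 (Nat.le_of_ble_eq_true h1) rfl ?_
    rw [pow_one]
    refine hmem (d := 12) ((toP_hom (by decide +kernel)).sub (toP_hom (by decide +kernel))) ?_
    rw [GP, gP_eval, Nat.eq_of_beq_eq_true h2, sub_self]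
  · refine hpw 1 2 (Nat.le_of_ble_eq_true h1) rfl ?_
    rw [Bool.and_eq_true, beq_iff_eq, beq_iff_eq] at h2
    have hX : ∀ (i : Fin 3) (n : ℕ), (X i ^ n : PolyQ).IsHomogeneous n := by
      intro i n
      simpa using (isHomogeneous_X ℚ i).pow n
    have ha : ta aP ∈ J := by
      refine hmem (d := 2) ?_ ?_
      · rw [aP]
        exact (((hX 0 2).add ((isHomogeneous_X ℚ 0).mul (isHomogeneous_X ℚ 1))).add (hX 1 2)).sub
          ((hX 2 2).C_mul 7)
      · have : eval (pt q) aP = (aZ q : ℚ) := by simp [aP, aZ, pt]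
        rw [this, h2.1]; simp
    have hb : ta bP ∈ J := by
      refine hmem (d := 6) ?_ ?_
      · rw [bP]
        exact ((((isHomogeneous_X ℚ 0).mul (isHomogeneous_X ℚ 1)).mul
          ((isHomogeneous_X ℚ 0).add (isHomogeneous_X ℚ 1))).pow 2).sub ((hX 2 6).C_mul 36)
      · have : eval (pt q) bP = (bZ q : ℚ) := by simp [bP, bZ, pt]
        rw [this, h2.2]; simp
    rw [GP_eq, pow_two]
    simp only [map_sub, map_add, map_mul, map_pow]
    refine Ideal.sub_mem _ (Ideal.add_mem _ (Ideal.mul_mem_right _ _ ?_)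
      (Ideal.mul_mem_right _ _ (Ideal.mul_mem_mul ha hb))) (Ideal.mul_mem_right _ _ ?_)
    · rw [pow_two]; exact Ideal.mul_mem_mul ha ha
    · rw [pow_two]; exact Ideal.mul_mem_mul hb hb

def forceI (x : ℤ) (k : ℤ → Bool) : Bool :=
  Int.rec (fun m => forceN m fun n => k (Int.ofNat n)) (fun m => forceN m fun n => k (Int.negSucc n)) x
def forceZ (l : List ℤ) : (List ℤ → Bool) → Bool :=
  List.rec (fun k => k []) (fun x _ ih k => forceI x fun y => ih fun ys => k (y :: ys)) l
def forceZZ (l : List (List ℤ)) : (List (List ℤ) → Bool) → Bool :=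
  List.rec (fun k => k []) (fun x _ ih k => forceZ x fun y => ih fun ys => k (y :: ys)) l

theorem forceI_eq (x : ℤ) (k : ℤ → Bool) : forceI x k = k x := by
  rcases x with m | m
  · exact forceN_eq m fun n => k (Int.ofNat n)
  · exact forceN_eq m fun n => k (Int.negSucc n)
theorem forceZ_eq (l : List ℤ) : ∀ k, forceZ l k = k l := by
  induction l with
  | nil => intro k; rfl
  | cons x l ih =>
    intro k
    have : forceZ (x :: l) k = forceI x fun y => forceZ l fun ys => k (y :: ys) := rfl
    rw [this, forceI_eq, ih]
theorem forceZZ_eq (l : List (List ℤ)) : ∀ k, forceZZ l k = k l := by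
  induction l with
  | nil => intro k; rfl
  | cons x l ih =>
    intro k
    have : forceZZ (x :: l) k = forceZ x fun y => forceZZ l fun ys => k (y :: ys) := rfl
    rw [this, forceZ_eq, ih]

def stepRow (n : Z3) (r r1 : List ℤ) : List ℤ :=
  List.zipWith (fun x (y : ℤ × ℤ) => n.1 * x + n.2.1 * y.1 + n.2.2 * y.2) r1 (List.zip r.tail r)
def stepT (n : Z3) (L : List (List ℤ)) : List (List ℤ) := List.zipWith (stepRow n) L L.tail

def contr (ns : List Z3) : List (List ℤ) → (List (List ℤ) → Bool) → Bool :=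
  List.rec (fun L k => k L) (fun n _ ih L k => forceZZ (stepT n L) fun L' => ih L' k) ns

def T33 : List (List ℤ) := (List.range 34).map fun a => (List.range (34 - a)).map fun b => wf a b

def entT (L : List (List ℤ)) (a b : ℕ) : ℤ := (L.getD a []).getD b 0

def pairT (L : List (List ℤ)) : List Q4 → ℤ
  | [] => 0
  | t :: l => (t.1 : ℤ) * entT L t.2.1 t.2.2.1 + pairT L l

theorem final_chk : (forceZZ T33 fun L => contr (idxF.map lnZ) L fun L' =>
    pairT L' gGp != pairT L' gGn) = true := by decide +kernel

theorem contr_eq (ns : List Z3) : ∀ (L : List (List ℤ)) (k : List (List ℤ) → Bool),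
    contr ns L k = k (ns.foldl (fun L n => stepT n L) L) := by
  induction ns with
  | nil => intro L k; rfl
  | cons n ns ih =>
    intro L k
    have : contr (n :: ns) L k = forceZZ (stepT n L) fun L' => contr ns L' k := rfl
    rw [this, forceZZ_eq, ih, List.foldl_cons]

def Shape (d : ℕ) (L : List (List ℤ)) : Prop :=
  L.length = d + 1 ∧ ∀ a, a ≤ d → (L.getD a []).length = d + 1 - a

def EL (L : List (List ℤ)) : PolyQ →ₗ[ℚ] ℚ :=
  (basisMonomials (Fin 3) ℚ).constr ℚ (fun m => (entT L (m 0) (m 1) : ℚ))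

theorem EL_mon (L : List (List ℤ)) (a b c : ℕ) (x : ℚ) :
    EL L (monomial (mon a b c) x) = x * (entT L a b : ℚ) := by
  have h : (monomial (mon a b c) x : PolyQ) = x • basisMonomials (Fin 3) ℚ (mon a b c) := by
    rw [coe_basisMonomials, smul_monomial, smul_eq_mul, mul_one]
  rw [h, map_smul, EL, Module.Basis.constr_basis, mon0, mon1, smul_eq_mul]

theorem step_row (n : Z3) {d : ℕ} {L : List (List ℤ)} (h : Shape (d + 1) L) {a : ℕ} (ha : a ≤ d) :
    (stepT n L).getD a [] = stepRow n (L.getD a []) (L.getD (a + 1) []) := by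
  have h1 : a < L.length := by rw [h.1]; omega
  have h2 : a + 1 < L.length := by rw [h.1]; omega
  simp [stepT, List.getD_eq_getElem?_getD, List.getElem?_zipWith, h1, h2]

theorem step_shape (n : Z3) {d : ℕ} {L : List (List ℤ)} (h : Shape (d + 1) L) :
    Shape d (stepT n L) := by
  refine ⟨by simp [stepT, h.1], ?_⟩
  intro a ha
  rw [step_row n h ha]
  have h1 := h.2 a (by omega)
  have h2 := h.2 (a + 1) (by omega)
  rw [stepRow, List.length_zipWith, List.length_zip, List.length_tail, h1, h2]
  omega

theorem step_ent (n : Z3) {d : ℕ} {L : List (List ℤ)} (h : Shape (d + 1) L) {a b : ℕ}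
    (hab : a + b ≤ d) : entT (stepT n L) a b =
      n.1 * entT L (a + 1) b + n.2.1 * entT L a (b + 1) + n.2.2 * entT L a b := by
  have h1 := h.2 a (by omega)
  have h2 := h.2 (a + 1) (by omega)
  unfold entT
  rw [step_row n h (by omega)]
  generalize L.getD a [] = r at *
  generalize L.getD (a + 1) [] = r1 at *
  have e1 : b < r1.length := by omega
  have e2 : b < r.length := by omega
  have e3 : b + 1 < r.length := by omega
  simp [stepRow, List.getD_eq_getElem?_getD, List.getElem?_zipWith, List.zip, e1, e2, e3]

theorem EL_step (n : Z3) {d : ℕ} {L : List (List ℤ)} (h : Shape (d + 1) L) {f : PolyQ}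
    (hf : f.IsHomogeneous d) : EL L (lf (pt n) * f) = EL (stepT n L) f := by
  have := hom_ext (Φ := EL L ∘ₗ LinearMap.mulLeft ℚ (lf (pt n))) (Ψ := EL (stepT n L)) (n := d) ?_ hf
  · exact this
  · intro i j k hijk
    rw [LinearMap.comp_apply, LinearMap.mulLeft_apply, EL_mon, step_ent n h (by omega)]
    have : lf (pt n) * monomial (mon i j k) 1 = monomial (mon (i + 1) j k) (n.1 : ℚ) +
        monomial (mon i (j + 1) k) (n.2.1 : ℚ) + monomial (mon i j (k + 1)) (n.2.2 : ℚ) := by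
      simp only [lf, pt, mon_eq, Matrix.cons_val_zero, Matrix.cons_val_one, Matrix.cons_val, C_1]
      ring
    rw [this, map_add, map_add, EL_mon, EL_mon, EL_mon]
    push_cast; ring

theorem prod_lf_hom (ns : List Z3) {f : PolyQ} {d : ℕ} (hf : f.IsHomogeneous d) :
    ((ns.map fun n => lf (pt n)).prod * f).IsHomogeneous (ns.length + d) := by
  induction ns with
  | nil => simpa using hf
  | cons n ns ih =>
    rw [List.map_cons, List.prod_cons, mul_assoc]
    have := (lf_hom (pt n)).mul ih
    rwa [show 1 + (ns.length + d) = (n :: ns).length + d by simp; omega] at this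

theorem EL_contr {f : PolyQ} {d : ℕ} (hf : f.IsHomogeneous d) (ns : List Z3) :
    ∀ L : List (List ℤ), Shape (ns.length + d) L →
      EL L ((ns.map fun n => lf (pt n)).prod * f) = EL (ns.foldl (fun L n => stepT n L) L) f := by
  induction ns with
  | nil => intro L _; simp
  | cons n ns ih =>
    intro L hL
    have hL' : Shape (ns.length + d + 1) L := by
      rwa [show (n :: ns).length + d = ns.length + d + 1 by simp; omega] at hL
    rw [List.map_cons, List.prod_cons, mul_assoc, EL_step n hL' (prod_lf_hom ns hf),
      ih _ (step_shape n hL'), List.foldl_cons]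

theorem EL_toP (L : List (List ℤ)) (l : List Q4) : EL L (toP l) = (pairT L l : ℚ) := by
  induction l with
  | nil => simp [toP, pairT]
  | cons t l ih => rw [toP_cons, map_add, ih, EL_mon, pairT]; push_cast; ring

theorem T33_shape : Shape 33 T33 := by
  refine ⟨by simp [T33], ?_⟩
  intro a ha
  have : a < 34 := by omega
  simp [T33, List.getD_eq_getElem?_getD, this]

theorem T33_ent {a b : ℕ} (h : a + b ≤ 33) : entT T33 a b = wf a b := by
  have h1 : a < 34 := by omega
  have h2 : b < 34 - a := by omega
  simp [entT, T33, List.getD_eq_getElem?_getD, h1, h2]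

theorem GP_hom : GP.IsHomogeneous 12 :=
  (toP_hom (by decide +kernel)).sub (toP_hom (by decide +kernel))

theorem ell_FQ : ell (sg FQ) ≠ 0 := by
  have h1 : sg FQ = ((idxF.map lnZ).map fun n => lf (pt n)).prod * GP := by
    rw [FQ, map_mul, sg_ta, map_list_prod, List.map_map, List.map_map]
    congr 3
    funext i
    exact sg_line i
  have hlen : (idxF.map lnZ).length = 21 := by simp [idxF]
  have hhom := prod_lf_hom (idxF.map lnZ) GP_hom
  rw [hlen] at hhom
  have h2 : ell (sg FQ) = EL T33 (sg FQ) := by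
    rw [h1]
    refine hom_ext (n := 33) ?_ hhom
    intro i j k hijk
    rw [ell_mon, EL_mon, if_pos hijk, T33_ent (by omega)]
  rw [h2, h1, EL_contr GP_hom _ _ (by rw [hlen]; exact T33_shape)]
  have h3 := final_chk
  rw [forceZZ_eq, contr_eq] at h3
  rw [GP, gP, map_sub, EL_toP, EL_toP, sub_ne_zero]
  have h4 := bne_iff_ne.mp h3
  exact_mod_cast h4

end

/-- For the ideal `I` of the 127 intersection points of the rational realization of
`A(31,3)`, the third symbolic power `I^(3) = ⋂_P I(P)³` is not contained in `I²`. -/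
theorem stmt9 :
    ¬ (⨅ P ∈ SQ, (pointIdealQ (Projectivization.rep P)) ^ 3) ≤
      (⨅ P ∈ SQ, pointIdealQ (Projectivization.rep P)) ^ 2 := by
  intro h
  exact ell_FQ (ell_sq (h FQ_mem))
end
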